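/- arXiv:2204.07529 — 8 statements merged into one kernel-verified Lean document; each statement's English description precedes it below -/
import Mathlib

section
/- Let α₁, α₂, p, c₁, c₂ > 0 with p > α₁·α₂, let ψ₁(s) = |s|^{α₁−1}·s and ψ₂(s) = |s|^{α₂−1}·s, let q be continuous on [a,b], and let f : ℝ → ℝ be odd and continuous with s·f(s) > 0 for s ≠ 0 and c₁·|s|^p ≤ |f(s)| ≤ c₂·|s|^p for all s ∈ ℝ. Suppose u is a nontrivial solution of (ψ₂((ψ₁(u'))'))' + q(x)·f(u) = 0 on [a,b] with u(a) = u(b) = 0, u(x) ≠ 0 for x ∈ (a,b), and (ψ₁(u'))'(ξ) = 0 for some ξ ∈ [a,b]. Let M = max_{a≤x≤b} |u(x)| > 0. Then (2/(b−a))^{α₂(α₁+1)} < c₂ · M^{p−α₁α₂} · ∫ₐ^b |q(x)| dx. -/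
open Set

theorem exists_mem_uIoo_sub_eq_deriv_mul {g : ℝ → ℝ} (hg : Differentiable ℝ g) {x y : ℝ}
    (hxy : x ≠ y) : ∃ t ∈ uIoo x y, g y - g x = deriv g t * (y - x) := by
  rcases lt_or_gt_of_ne hxy with h | h
  · obtain ⟨t, ht, e⟩ := exists_deriv_eq_slope g h hg.continuous.continuousOn hg.differentiableOn
    refine ⟨t, by rwa [uIoo_of_lt h], ?_⟩
    rw [e, div_mul_cancel₀ _ (sub_ne_zero.2 h.ne')]
  · obtain ⟨t, ht, e⟩ := exists_deriv_eq_slope g h hg.continuous.continuousOn hg.differentiableOn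
    refine ⟨t, by rwa [uIoo_of_gt h], ?_⟩
    have : x - y ≠ 0 := sub_ne_zero.2 h.ne'
    rw [e]
    field_simp
    ring

theorem abs_signed_rpow {r : ℝ} (hr : r ≠ 0) (s : ℝ) : |(|s| ^ (r - 1) * s)| = |s| ^ r := by
  rcases eq_or_ne s 0 with rfl | hs
  · simp [Real.zero_rpow hr]
  · rw [abs_mul, Real.abs_rpow_of_nonneg (abs_nonneg s), abs_abs,
      Real.rpow_sub_one (abs_ne_zero.2 hs), div_mul_cancel₀ _ (abs_ne_zero.2 hs)]

theorem abs_sub_le_integral_of_abs_deriv_le {z h : ℝ → ℝ} {a b x y : ℝ} (hab : a ≤ b)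
    (hx : x ∈ Icc a b) (hy : y ∈ Icc a b) (hz : Differentiable ℝ z)
    (hz' : ContinuousOn (deriv z) (Icc a b)) (hh : ContinuousOn h (Icc a b))
    (hle : ∀ t ∈ Icc a b, |deriv z t| ≤ h t) :
    |z y - z x| ≤ ∫ t in a..b, h t := by
  have hsub : uIcc x y ⊆ Icc a b := ordConnected_Icc.uIcc_subset hx hy
  have hint : IntervalIntegrable (fun t => |deriv z t|) MeasureTheory.volume a b :=
    ContinuousOn.intervalIntegrable (by rw [uIcc_of_le hab]; exact hz'.abs)
  rw [← intervalIntegral.integral_eq_sub_of_hasDerivAt (f := z) (f' := deriv z)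
    (fun t _ => (hz t).hasDerivAt) (hz'.mono hsub).intervalIntegrable]
  calc |(∫ t in x..y, deriv z t)| ≤ |(∫ t in x..y, |deriv z t|)| :=
        intervalIntegral.norm_integral_le_abs_integral_norm (f := deriv z)
    _ ≤ |(∫ t in a..b, |deriv z t|)| := by
        refine intervalIntegral.abs_integral_mono_interval ?_
          (Filter.Eventually.of_forall fun t => abs_nonneg _) hint
        exact uIoc_subset_uIoc_of_uIcc_subset_uIcc (by rwa [uIcc_of_le hab])
    _ = ∫ t in a..b, |deriv z t| :=
        abs_of_nonneg (intervalIntegral.integral_nonneg hab fun t _ => abs_nonneg _)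
    _ ≤ ∫ t in a..b, h t :=
        intervalIntegral.integral_mono_on hab hint
          (ContinuousOn.intervalIntegrable (by rwa [uIcc_of_le hab])) hle

theorem deriv_eq_zero_of_isMaxOn_abs {u : ℝ → ℝ} {a b c : ℝ} (hu : DifferentiableAt ℝ u c)
    (hc : c ∈ Ioo a b) (hmax : ∀ x ∈ Icc a b, |u x| ≤ |u c|) (hne : u c ≠ 0) :
    deriv u c = 0 := by
  have hloc : IsLocalMax (fun x => u x ^ 2) c := by
    filter_upwards [Icc_mem_nhds hc.1 hc.2] with x hx using sq_le_sq.2 (hmax x hx)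
  have h := hloc.hasDerivAt_eq_zero (hu.hasDerivAt.pow 2)
  simpa [hne] using h

theorem max_location_two_point
    (α₁ α₂ p c₁ c₂ a b ξ M : ℝ) (q f u : ℝ → ℝ)
    (hα₁ : 0 < α₁) (hα₂ : 0 < α₂) (hp : 0 < p) (hc₁ : 0 < c₁) (hc₂ : 0 < c₂)
    (hpα : α₁ * α₂ < p) (hab : a < b)
    (hq : ContinuousOn q (Icc a b))
    (hfcont : Continuous f) (hfodd : ∀ s, f (-s) = -f s)
    (hfsgn : ∀ s : ℝ, s ≠ 0 → 0 < s * f s)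
    (hfbound : ∀ s : ℝ, c₁ * |s| ^ p ≤ |f s| ∧ |f s| ≤ c₂ * |s| ^ p)
    (hu : Differentiable ℝ u)
    (hu1 : Differentiable ℝ (fun x => |deriv u x| ^ (α₁ - 1) * deriv u x))
    (hu2 : Differentiable ℝ (fun x =>
      |deriv (fun y => |deriv u y| ^ (α₁ - 1) * deriv u y) x| ^ (α₂ - 1) *
        deriv (fun y => |deriv u y| ^ (α₁ - 1) * deriv u y) x))
    (hode : ∀ x ∈ Icc a b,
      deriv (fun y =>
        |deriv (fun z => |deriv u z| ^ (α₁ - 1) * deriv u z) y| ^ (α₂ - 1) *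
          deriv (fun z => |deriv u z| ^ (α₁ - 1) * deriv u z) y) x
        + q x * f (u x) = 0)
    (hua : u a = 0) (hub : u b = 0)
    (hune : ∀ x ∈ Ioo a b, u x ≠ 0)
    (hξmem : ξ ∈ Icc a b)
    (hξ : deriv (fun y => |deriv u y| ^ (α₁ - 1) * deriv u y) ξ = 0)
    (hM : IsGreatest ((fun x => |u x|) '' Icc a b) M) (hMpos : 0 < M) :
    (2 / (b - a)) ^ (α₂ * (α₁ + 1)) <
      c₂ * M ^ (p - α₁ * α₂) * ∫ x in a..b, |q x| := by
  set w : ℝ → ℝ := fun x => |deriv u x| ^ (α₁ - 1) * deriv u x with hw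
  set z : ℝ → ℝ := fun x => |deriv w x| ^ (α₂ - 1) * deriv w x with hz
  obtain ⟨⟨c, hc, hcM⟩, hMub⟩ := hM
  replace hcM : |u c| = M := hcM
  replace hMub : ∀ x ∈ Icc a b, |u x| ≤ M := fun x hx => hMub ⟨x, hx, rfl⟩
  have huc : u c ≠ 0 := abs_pos.1 (hcM ▸ hMpos)
  have hca : a ≠ c := by rintro rfl; exact huc hua
  have hcb : b ≠ c := by rintro rfl; exact huc hub
  have hcI : c ∈ Ioo a b := ⟨lt_of_le_of_ne hc.1 hca, lt_of_le_of_ne hc.2 hcb.symm⟩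
  have hu'c : deriv u c = 0 :=
    deriv_eq_zero_of_isMaxOn_abs (hu c) hcI (fun x hx => hcM ▸ hMub x hx) huc
  have hbound : ∀ t ∈ Icc a b, |deriv w t| ^ α₂ ≤ c₂ * M ^ p * ∫ x in a..b, |q x| := by
    intro t ht
    have hzξ : z ξ = 0 := by simp only [hz, hξ, mul_zero]
    have hz' : ∀ x ∈ Icc a b, deriv z x = -(q x * f (u x)) := fun x hx =>
      eq_neg_of_add_eq_zero_left (hode x hx)
    have h := abs_sub_le_integral_of_abs_deriv_le (h := fun x => c₂ * M ^ p * |q x|) hab.le hξmem ht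
      hu2 ((hq.mul (hfcont.comp hu.continuous).continuousOn).neg.congr hz')
      (continuousOn_const.mul hq.abs) (fun x hx => by
        rw [hz' x hx, abs_neg, abs_mul, mul_comm]
        gcongr
        refine (hfbound _).2.trans ?_
        gcongr
        exact hMub x hx)
    rw [hzξ, sub_zero, intervalIntegral.integral_const_mul, abs_signed_rpow hα₂.ne'] at h
    exact h
  obtain ⟨e, he, hue, hec, hdist⟩ :
      ∃ e ∈ Icc a b, u e = 0 ∧ e ≠ c ∧ |c - e| ≤ (b - a) / 2 := by
    rcases le_total (c - a) (b - c) with h | h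
    · exact ⟨a, left_mem_Icc.2 hab.le, hua, hca,
        by rw [abs_of_nonneg] <;> linarith [hcI.1]⟩
    · exact ⟨b, right_mem_Icc.2 hab.le, hub, hcb,
        by rw [abs_of_nonpos] <;> linarith [hcI.2]⟩
  set d := (b - a) / 2 with hd
  have hdpos : 0 < d := by rw [hd]; linarith
  obtain ⟨η, hη, hMη⟩ := exists_mem_uIoo_sub_eq_deriv_mul hu hec
  have hηI : η ∈ Icc a b := ordConnected_Icc.uIcc_subset he hc (uIoo_subset_uIcc_self hη)
  have hηc : c ≠ η := by rintro rfl; simp at hη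
  have hηd : |η - c| < d := by
    refine lt_of_lt_of_le ?_ hdist
    rcases lt_or_gt_of_ne hec with h | h
    · rw [uIoo_of_lt h] at hη
      rw [abs_of_neg (by linarith [hη.2]), abs_of_pos (by linarith)]
      linarith [hη.1]
    · rw [uIoo_of_gt h] at hη
      rw [abs_of_pos (by linarith [hη.1]), abs_of_neg (by linarith)]
      linarith [hη.2]
  obtain ⟨ζ, hζ, hwζ⟩ := exists_mem_uIoo_sub_eq_deriv_mul hu1 hηc
  have hζI : ζ ∈ Icc a b := ordConnected_Icc.uIcc_subset hc hηI (uIoo_subset_uIcc_self hζ)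
  have hMle : M ≤ |deriv u η| * d := by
    rw [hue, sub_zero] at hMη
    rw [← hcM, hMη, abs_mul]
    gcongr
  have hu'η : 0 < |deriv u η| := pos_of_mul_pos_left (hMpos.trans_le hMle) hdpos.le
  have hw_eq : |deriv u η| ^ α₁ = |deriv w ζ| * |η - c| := by
    have hwc : w c = 0 := by simp only [hw, hu'c, mul_zero]
    rw [← abs_mul, ← hwζ, hwc, sub_zero, abs_signed_rpow hα₁.ne']
  have hvpos : 0 < |deriv w ζ| :=
    pos_of_mul_pos_left (hw_eq ▸ Real.rpow_pos_of_pos hu'η α₁) (abs_nonneg _)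
  have hM1 : M ^ α₁ < |deriv w ζ| * d ^ (α₁ + 1) := by
    calc M ^ α₁ ≤ (|deriv u η| * d) ^ α₁ := by gcongr
      _ = |deriv w ζ| * |η - c| * d ^ α₁ := by
        rw [Real.mul_rpow hu'η.le hdpos.le, hw_eq]
      _ < |deriv w ζ| * d * d ^ α₁ := by gcongr
      _ = |deriv w ζ| * d ^ (α₁ + 1) := by rw [Real.rpow_add_one hdpos.ne']; ring
  have hM2 : M ^ (α₁ * α₂) < (c₂ * M ^ p * ∫ x in a..b, |q x|) * d ^ (α₂ * (α₁ + 1)) := by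
    calc M ^ (α₁ * α₂) = (M ^ α₁) ^ α₂ := Real.rpow_mul hMpos.le _ _
      _ < (|deriv w ζ| * d ^ (α₁ + 1)) ^ α₂ := by gcongr
      _ = |deriv w ζ| ^ α₂ * d ^ (α₂ * (α₁ + 1)) := by
        rw [Real.mul_rpow hvpos.le (by positivity), ← Real.rpow_mul hdpos.le, mul_comm (α₁ + 1)]
      _ ≤ _ := by gcongr; exact hbound ζ hζI
  have h2d : 2 / (b - a) = d⁻¹ := by rw [hd, inv_div]
  rw [h2d, Real.inv_rpow hdpos.le, inv_lt_iff_one_lt_mul₀ (by positivity), Real.rpow_sub hMpos]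
  have hMpow : 0 < M ^ (α₁ * α₂) := by positivity
  rw [← div_lt_div_iff_of_pos_right hMpow, div_self hMpow.ne'] at hM2
  convert hM2 using 1
  ring
end

section
/- Let ψ₁, ψ₂, f satisfy (H1)–(H5) with ψ₂ either convex or concave on [0,∞), let q : [0,∞) → ℝ be continuous, and let u be a nontrivial solution of (E): (ψ₂((ψ₁(u'))'))' + q(x)·f(u) = 0 on [0,∞) such that Φ(u(x)) is bounded on the set where u(x) ≠ 0. Let (t_k)_{k≥1} be a strictly increasing sequence of zeros of u in [0,∞) with u ≠ 0 between consecutive zeros. Suppose there exists σ > 1 such that for every M > 0, ∫_t^{t+M} |q(s)|^σ ds → 0 as t → ∞. Then t_{n+2} − t_n → ∞ as n → ∞. -/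
open Set Filter

theorem StrictMono.abs_eq_of_odd {ψ : ℝ → ℝ} (hodd : ∀ s, ψ (-s) = -ψ s) (hmono : StrictMono ψ)
    (s : ℝ) : |ψ s| = ψ |s| := by
  have h0 : ψ 0 = 0 := by
    have := hodd 0
    rw [neg_zero] at this
    linarith
  rcases le_total 0 s with hs | hs
  · rw [abs_of_nonneg hs, abs_of_nonneg (h0 ▸ hmono.monotone hs)]
  · rw [abs_of_nonpos hs, hodd, abs_of_nonpos (h0 ▸ hmono.monotone hs)]

theorem StrictMono.pos_of_odd {ψ : ℝ → ℝ} (hodd : ∀ s, ψ (-s) = -ψ s) (hmono : StrictMono ψ)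
    {s : ℝ} (hs : 0 < s) : 0 < ψ s := by
  have h1 := hmono (show -s < s by linarith)
  rw [hodd] at h1
  linarith

/-- The mean value inequality on an interval, with a bound on the derivative. -/
theorem abs_sub_le_of_abs_deriv_le {g : ℝ → ℝ} (hg : Differentiable ℝ g) {a b K : ℝ}
    (hK : ∀ x ∈ Icc a b, |deriv g x| ≤ K) {x y : ℝ} (hx : x ∈ Icc a b) (hy : y ∈ Icc a b) :
    |g x - g y| ≤ K * (b - a) := by
  have h1 := (convex_Icc a b).norm_image_sub_le_of_norm_deriv_le (f := g) (C := K)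
    (fun z _ => hg z) (fun z hz => hK z hz) hy hx
  simp only [Real.norm_eq_abs] at h1
  have hK0 : 0 ≤ K := (abs_nonneg _).trans (hK x hx)
  have h2 : |x - y| ≤ b - a := by
    rw [abs_le]
    constructor <;> linarith [hx.1, hx.2, hy.1, hy.2]
  exact h1.trans (mul_le_mul_of_nonneg_left h2 hK0)

/-- A Lyapunov type inequality: three zeros `a < c < b` of a solution force a lower bound on the
integral of the coefficient over `[a, b]`. -/
theorem lyapunov_of_three_zeros
    {ψ₁ ψ₂ q f u : ℝ → ℝ}
    (hψ₁odd : ∀ s, ψ₁ (-s) = -ψ₁ s) (hψ₂odd : ∀ s, ψ₂ (-s) = -ψ₂ s)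
    (hψ₁mono : StrictMono ψ₁) (hψ₂mono : StrictMono ψ₂)
    (hψ₁sub : ∀ x y : ℝ, 0 ≤ x → 0 ≤ y → ψ₁ (x * y) ≤ ψ₁ x * ψ₁ y)
    (hψ₂super : ∀ x y : ℝ, 0 ≤ x → 0 ≤ y → ψ₂ x * ψ₂ y ≤ ψ₂ (x * y))
    (hfcont : Continuous f) (hfodd : ∀ s, f (-s) = -f s)
    (hu : Differentiable ℝ u)
    (hu1 : Differentiable ℝ (fun x => ψ₁ (deriv u x)))
    (hu2 : Differentiable ℝ (fun x => ψ₂ (deriv (fun y => ψ₁ (deriv u y)) x)))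
    {a b c M C : ℝ} (hq : ContinuousOn q (Icc a b))
    (hode : ∀ x ∈ Icc a b,
      deriv (fun y => ψ₂ (deriv (fun z => ψ₁ (deriv u z)) y)) x + q x * f (u x) = 0)
    (hC : ∀ x ∈ Icc a b, u x ≠ 0 → |f (u x) / ψ₂ (ψ₁ (u x))| ≤ C)
    (hac : a < c) (hcb : c < b) (hM : b - a ≤ M)
    (hua : u a = 0) (huc : u c = 0) (hub : u b = 0)
    (hne : ∃ x ∈ Icc a b, u x ≠ 0) :
    ψ₂ (1 / (ψ₁ M * M)) ≤ C * ∫ s in a..b, |q s| := by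
  have hab : a ≤ b := (hac.trans hcb).le
  have hM0 : 0 < M := by linarith
  have hne' : (Icc a b).Nonempty := ⟨a, left_mem_Icc.2 hab⟩
  have habs₁ := hψ₁mono.abs_eq_of_odd hψ₁odd
  have habs₂ := hψ₂mono.abs_eq_of_odd hψ₂odd
  have hpos₁ : ∀ {s : ℝ}, 0 < s → 0 < ψ₁ s := fun h => hψ₁mono.pos_of_odd hψ₁odd h
  have hpos₂ : ∀ {s : ℝ}, 0 < s → 0 < ψ₂ s := fun h => hψ₂mono.pos_of_odd hψ₂odd h
  have hz₁ : ψ₁ 0 = 0 := by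
    have := hψ₁odd 0
    rw [neg_zero] at this
    linarith
  have hz₂ : ψ₂ 0 = 0 := by
    have := hψ₂odd 0
    rw [neg_zero] at this
    linarith
  have hf0 : f 0 = 0 := by
    have := hfodd 0
    rw [neg_zero] at this
    linarith
  set v : ℝ → ℝ := fun x => ψ₁ (deriv u x) with hv
  set w : ℝ → ℝ := fun x => ψ₂ (deriv v x) with hw
  obtain ⟨x₀, hx₀, hmax₀⟩ := isCompact_Icc.exists_isMaxOn hne' hu.continuous.abs.continuousOn
  obtain ⟨x₁, hx₁, hmax₁⟩ := isCompact_Icc.exists_isMaxOn hne' hu1.continuous.abs.continuousOn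
  obtain ⟨x₂, hx₂, hmax₂⟩ := isCompact_Icc.exists_isMaxOn hne' hu2.continuous.abs.continuousOn
  -- the zeros of `u'` and of `v'` provided by Rolle's theorem
  obtain ⟨y₁, hy₁, hdy₁⟩ := exists_deriv_eq_zero hac hu.continuous.continuousOn (hua.trans huc.symm)
  obtain ⟨y₂, hy₂, hdy₂⟩ := exists_deriv_eq_zero hcb hu.continuous.continuousOn (huc.trans hub.symm)
  have hvy₁ : v y₁ = 0 := by simp [hv, hdy₁, hz₁]
  have hvy₂ : v y₂ = 0 := by simp [hv, hdy₂, hz₁]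
  obtain ⟨d, hd, hdd⟩ := exists_deriv_eq_zero (hy₁.2.trans hy₂.1) hu1.continuous.continuousOn
    (hvy₁.trans hvy₂.symm)
  have hwd : w d = 0 := by simp only [hw, hdd, hz₂]
  have hy₁' : y₁ ∈ Icc a b := ⟨hy₁.1.le, by linarith [hy₁.2]⟩
  have hd' : d ∈ Icc a b := ⟨by linarith [hy₁.1, hd.1], by linarith [hy₂.2, hd.2]⟩
  set m := |u x₀| with hm
  set K := |deriv u x₁| with hKdef
  set L := |deriv v x₂| with hLdef
  set A := ψ₁ M * M with hA
  have hA0 : 0 < A := mul_pos (hpos₁ hM0) hM0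
  have hm0 : 0 < m := by
    obtain ⟨x, hx, hxne⟩ := hne
    exact (abs_pos.2 hxne).trans_le (hmax₀ hx)
  have hC0 : 0 ≤ C := by
    obtain ⟨x, hx, hxne⟩ := hne
    exact (abs_nonneg _).trans (hC x hx hxne)
  have hK : ∀ x ∈ Icc a b, |deriv u x| ≤ K := by
    intro x hx
    have h : |v x| ≤ |v x₁| := hmax₁ hx
    simp only [hv, habs₁] at h
    exact hψ₁mono.le_iff_le.1 h
  have hL : ∀ x ∈ Icc a b, |deriv v x| ≤ L := by
    intro x hx
    have h : |w x| ≤ |w x₂| := hmax₂ hx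
    simp only [hw, habs₂] at h
    exact hψ₂mono.le_iff_le.1 h
  have hK0 : 0 ≤ K := abs_nonneg _
  have hL0 : 0 ≤ L := abs_nonneg _
  have hmK : m ≤ M * K := by
    have h := abs_sub_le_of_abs_deriv_le hu hK hx₀ (left_mem_Icc.2 hab)
    rw [hua, sub_zero] at h
    nlinarith
  have hKL : ψ₁ K ≤ M * L := by
    have h := abs_sub_le_of_abs_deriv_le hu1 hL hx₁ hy₁'
    have hKv : |v x₁| = ψ₁ K := habs₁ _
    change |v x₁ - v y₁| ≤ _ at h
    rw [hvy₁, sub_zero, hKv] at h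
    nlinarith
  have hmL : ψ₁ m ≤ A * L := by
    have h1 := (hψ₁mono.monotone hmK).trans (hψ₁sub M K hM0.le hK0)
    have h2 := mul_le_mul_of_nonneg_left hKL (hpos₁ hM0).le
    rw [hA]
    linarith
  have hfbd : ∀ x ∈ Icc a b, |f (u x)| ≤ C * ψ₂ (ψ₁ m) := by
    intro x hx
    have hP : 0 < ψ₂ (ψ₁ m) := hpos₂ (hpos₁ hm0)
    by_cases hux : u x = 0
    · rw [hux, hf0, abs_zero]
      positivity
    · have h := hC x hx hux
      rw [abs_div, habs₂, habs₁, div_le_iff₀ (hpos₂ (hpos₁ (abs_pos.2 hux)))] at h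
      exact h.trans (mul_le_mul_of_nonneg_left
        (hψ₂mono.monotone (hψ₁mono.monotone (hmax₀ hx))) hC0)
  have hqi : IntervalIntegrable (fun s => |q s|) MeasureTheory.volume a b :=
    ContinuousOn.intervalIntegrable (by rw [uIcc_of_le hab]; exact hq.abs)
  have hsub : uIcc d x₂ ⊆ Icc a b := by
    rw [← uIcc_of_le hab] at hd' hx₂ ⊢
    exact uIcc_subset_uIcc hd' hx₂
  have hLint : ψ₂ L ≤ (C * ψ₂ (ψ₁ m)) * ∫ s in a..b, |q s| := by
    have hder : ∀ x ∈ uIcc d x₂, HasDerivAt w (-(q x * f (u x))) x := by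
      intro x hx
      have h : deriv w x = -(q x * f (u x)) := eq_neg_of_add_eq_zero_left (hode x (hsub hx))
      rw [← h]
      exact (hu2 x).hasDerivAt
    have hcont : ContinuousOn (fun x => -(q x * f (u x))) (Icc a b) :=
      (hq.mul (hfcont.comp hu.continuous).continuousOn).neg
    have hftc := intervalIntegral.integral_eq_sub_of_hasDerivAt hder
      (hcont.mono hsub).intervalIntegrable
    rw [hwd, sub_zero] at hftc
    have hLw : |w x₂| = ψ₂ L := habs₂ _
    have hcont' : ContinuousOn (fun x => -(q x * f (u x))) (uIcc a b) := by
      rwa [uIcc_of_le hab]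
    calc ψ₂ L = |∫ x in d..x₂, -(q x * f (u x))| := by rw [hftc, hLw]
      _ ≤ |(∫ x in d..x₂, |(-(q x * f (u x)))|)| := by
          simpa only [Real.norm_eq_abs] using
            intervalIntegral.norm_integral_le_abs_integral_norm (a := d) (b := x₂)
              (μ := MeasureTheory.volume) (f := fun x => -(q x * f (u x)))
      _ ≤ |(∫ x in a..b, |(-(q x * f (u x)))|)| := by
          refine intervalIntegral.abs_integral_mono_interval ?_
            (MeasureTheory.ae_of_all _ fun _ => abs_nonneg _) hcont'.abs.intervalIntegrable
          refine uIoc_subset_uIoc_of_uIcc_subset_uIcc ?_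
          rwa [uIcc_of_le hab]
      _ = ∫ x in a..b, |-(q x * f (u x))| :=
          abs_of_nonneg (intervalIntegral.integral_nonneg hab fun _ _ => abs_nonneg _)
      _ ≤ ∫ x in a..b, (C * ψ₂ (ψ₁ m)) * |q x| := by
          refine intervalIntegral.integral_mono_on hab hcont'.abs.intervalIntegrable
            (hqi.const_mul _) fun x hx => ?_
          rw [abs_neg, abs_mul, mul_comm]
          exact mul_le_mul_of_nonneg_right (hfbd x hx) (abs_nonneg _)
      _ = _ := intervalIntegral.integral_const_mul _ _
  have hP : 0 < ψ₂ (ψ₁ m) := hpos₂ (hpos₁ hm0)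
  have hQ : 0 < ψ₂ (1 / A) := hpos₂ (by positivity)
  have h1 : ψ₂ (ψ₁ m) * ψ₂ (1 / A) ≤ ψ₂ L := by
    have h2 := hψ₂super (A * L) (1 / A) (by positivity) (by positivity)
    rw [show A * L * (1 / A) = L by field_simp] at h2
    exact (mul_le_mul_of_nonneg_right (hψ₂mono.monotone hmL) hQ.le).trans h2
  refine le_of_mul_le_mul_left ?_ hP
  calc ψ₂ (ψ₁ m) * ψ₂ (1 / A) ≤ (C * ψ₂ (ψ₁ m)) * ∫ s in a..b, |q s| := h1.trans hLint
    _ = _ := by ring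

theorem le_add_rpow_mul_rpow {σ δ x : ℝ} (hσ : 1 < σ) (hδ : 0 < δ) (hx : 0 ≤ x) :
    x ≤ δ + δ ^ (1 - σ) * x ^ σ := by
  have h0 : 0 ≤ δ ^ (1 - σ) := Real.rpow_nonneg hδ.le _
  have h1 : 0 ≤ x ^ σ := Real.rpow_nonneg hx _
  rcases le_total x δ with h | h
  · nlinarith [mul_nonneg h0 h1]
  · have hx0 : 0 < x := hδ.trans_le h
    have h2 : x ^ (1 - σ) ≤ δ ^ (1 - σ) := Real.rpow_le_rpow_of_nonpos hδ h (by linarith)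
    have h3 : x ^ (1 - σ) * x ^ σ = x := by
      rw [← Real.rpow_add hx0]
      simp
    have h4 := mul_le_mul_of_nonneg_right h2 h1
    linarith

/-- Vanishing of the `σ`-th power integrals over windows of length `M`, for some `σ > 1`, implies
vanishing of the integrals of `|q|` over the windows. -/
theorem tendsto_integral_abs_of_tendsto_integral_rpow {q : ℝ → ℝ} {σ M : ℝ}
    (hq : ContinuousOn q (Ici 0)) (hσ : 1 < σ) (hM : 0 < M)
    (h : Tendsto (fun T => ∫ s in T..(T + M), |q s| ^ σ) atTop (nhds 0)) :
    Tendsto (fun T => ∫ s in T..(T + M), |q s|) atTop (nhds 0) := by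
  rw [Metric.tendsto_nhds]
  intro ε hε
  set δ := ε / (2 * M) with hδdef
  have hδ : 0 < δ := by positivity
  have h' : Tendsto (fun T => δ ^ (1 - σ) * ∫ s in T..(T + M), |q s| ^ σ) atTop (nhds 0) := by
    simpa using h.const_mul (δ ^ (1 - σ))
  filter_upwards [h'.eventually_lt_const (half_pos hε), eventually_ge_atTop 0] with T hT hT0
  have hTM : T ≤ T + M := by linarith
  have hcont : ContinuousOn (fun s => |q s|) (uIcc T (T + M)) := by
    rw [uIcc_of_le hTM]
    exact (hq.mono fun x hx => hT0.trans hx.1).abs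
  have hcont' : ContinuousOn (fun s => |q s| ^ σ) (uIcc T (T + M)) :=
    hcont.rpow_const fun _ _ => Or.inr (by linarith)
  rw [Real.dist_0_eq_abs,
    abs_of_nonneg (intervalIntegral.integral_nonneg hTM fun _ _ => abs_nonneg _)]
  have hi := (hcont'.intervalIntegrable (μ := MeasureTheory.volume)).const_mul (δ ^ (1 - σ))
  calc ∫ s in T..(T + M), |q s|
      ≤ ∫ s in T..(T + M), (δ + δ ^ (1 - σ) * |q s| ^ σ) :=
        intervalIntegral.integral_mono_on hTM hcont.intervalIntegrable
          (intervalIntegrable_const.add hi)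
          fun s _ => le_add_rpow_mul_rpow hσ hδ (abs_nonneg _)
    _ = M * δ + δ ^ (1 - σ) * ∫ s in T..(T + M), |q s| ^ σ := by
        rw [intervalIntegral.integral_add intervalIntegrable_const hi,
          intervalIntegral.integral_const_mul, intervalIntegral.integral_const]
        simp
    _ < M * δ + ε / 2 := by linarith
    _ = ε := by
        rw [hδdef]
        field_simp
        ring

/-- Over the gaps of length at most `M` of an increasing sequence, the integral of `|q|` is
eventually small. -/
theorem eventually_integral_abs_lt {q : ℝ → ℝ} {t : ℕ → ℝ} {M : ℝ}
    (hq : ContinuousOn q (Ici 0)) (ht0 : ∀ n, 0 ≤ t n) (ht : StrictMono t)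
    (h : Tendsto (fun T => ∫ s in T..(T + M), |q s|) atTop (nhds 0)) {ε : ℝ} (hε : 0 < ε) :
    ∀ᶠ n in atTop, t (n + 2) - t n ≤ M → ∫ s in t n..t (n + 2), |q s| < ε := by
  have hle : ∀ n, t n ≤ t (n + 2) := fun n => ht.monotone (by lia)
  rcases tendsto_atTop_of_monotone ht.monotone with htop | ⟨l, hl⟩
  · filter_upwards [(h.comp htop).eventually_lt_const hε] with n hn hnM
    refine lt_of_le_of_lt ?_ hn
    refine intervalIntegral.integral_mono_interval le_rfl (hle n) (by linarith)
      (MeasureTheory.ae_of_all _ fun _ => abs_nonneg _) ?_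
    refine ContinuousOn.intervalIntegrable ?_
    rw [uIcc_of_le (by linarith [hle n])]
    exact (hq.mono fun x hx => (ht0 n).trans hx.1).abs
  · obtain ⟨B, hB⟩ := isCompact_Icc.exists_bound_of_continuousOn
      (hq.mono (Icc_subset_Ici_self : Icc 0 l ⊆ Ici 0))
    have hgap : Tendsto (fun n => B * (t (n + 2) - t n)) atTop (nhds 0) := by
      simpa using ((hl.comp (tendsto_add_atTop_nat 2)).sub hl).const_mul B
    filter_upwards [hgap.eventually_lt_const hε] with n hn _
    refine lt_of_le_of_lt ?_ hn
    have hbd := intervalIntegral.norm_integral_le_of_norm_le_const (a := t n) (b := t (n + 2))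
      (f := fun s => |q s|) (C := B) fun x hx => by
        rw [uIoc_of_le (hle n)] at hx
        rw [norm_abs_eq_norm]
        exact hB x ⟨(ht0 n).trans hx.1.le, hx.2.trans (ht.monotone.ge_of_tendsto hl _)⟩
    rw [abs_of_nonneg (sub_nonneg.2 (hle n))] at hbd
    exact (Real.le_norm_self _).trans hbd

theorem zeros_spread_out
    (ψ₁ ψ₂ q f u : ℝ → ℝ) (t : ℕ → ℝ)
    -- (H1)
    (hψ₁cont : Continuous ψ₁) (hψ₂cont : Continuous ψ₂)
    (hψ₁odd : ∀ s, ψ₁ (-s) = -ψ₁ s) (hψ₂odd : ∀ s, ψ₂ (-s) = -ψ₂ s)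
    (hψ₁mono : StrictMono ψ₁) (hψ₂mono : StrictMono ψ₂)
    -- (H2)
    (hψ₁sub : ∀ x y : ℝ, 0 ≤ x → 0 ≤ y → ψ₁ (x * y) ≤ ψ₁ x * ψ₁ y)
    (hψ₁conv : ConvexOn ℝ (Ioi (0 : ℝ)) (fun s => 1 / ψ₁ s))
    -- (H3)
    (hψ₂super : ∀ x y : ℝ, 0 ≤ x → 0 ≤ y → ψ₂ x * ψ₂ y ≤ ψ₂ (x * y))
    (hψ₂cc : ConvexOn ℝ (Ici (0 : ℝ)) ψ₂ ∨ ConcaveOn ℝ (Ici (0 : ℝ)) ψ₂)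
    -- (H4)
    (hq : ContinuousOn q (Ici (0 : ℝ)))
    -- (H5)
    (hfcont : Continuous f) (hfodd : ∀ s, f (-s) = -f s)
    (hfsgn : ∀ s : ℝ, s ≠ 0 → 0 < s * f s)
    -- u is a solution of (E) on Ici (0 : ℝ)
    (hu : Differentiable ℝ u)
    (hu1 : Differentiable ℝ (fun x => ψ₁ (deriv u x)))
    (hu2 : Differentiable ℝ (fun x => ψ₂ (deriv (fun y => ψ₁ (deriv u y)) x)))
    (hode : ∀ x ∈ Ici (0 : ℝ),
      deriv (fun y => ψ₂ (deriv (fun z => ψ₁ (deriv u z)) y)) x + q x * f (u x) = 0)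
    -- u is nontrivial
    (hnontriv : ∃ x ∈ Ici (0 : ℝ), u x ≠ 0)
    -- Φ(u(x)) is bounded where u(x) ≠ 0
    (hΦbdd : ∃ C : ℝ, ∀ x ∈ Ici (0 : ℝ), u x ≠ 0 →
      |f (u x) / ψ₂ (ψ₁ (u x))| ≤ C)
    -- (t_k) is a strictly increasing sequence of zeros of u in [0,∞),
    -- with u ≠ 0 between consecutive zeros
    (ht0 : ∀ n, 0 ≤ t n) (htmono : StrictMono t)
    (htz : ∀ n, u (t n) = 0)
    (htbetween : ∀ n, ∀ x ∈ Ioo (t n) (t (n + 1)), u x ≠ 0)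
    -- integral smallness condition on q
    (hσ : ∃ σ > (1 : ℝ), ∀ M > (0 : ℝ),
      Tendsto (fun T => ∫ s in T..(T + M), |q s| ^ σ) atTop (nhds 0)) :
    Tendsto (fun n => t (n + 2) - t n) atTop atTop := by
  obtain ⟨C, hC⟩ := hΦbdd
  obtain ⟨σ, hσ1, hσ⟩ := hσ
  rw [tendsto_atTop]
  intro M'
  set M := max M' 1 with hMdef
  have hM0 : 0 < M := lt_of_lt_of_le one_pos (le_max_right _ _)
  have hbound : 0 < ψ₂ (1 / (ψ₁ M * M)) := by
    have := hψ₁mono.pos_of_odd hψ₁odd hM0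
    exact hψ₂mono.pos_of_odd hψ₂odd (by positivity)
  have hε : 0 < ψ₂ (1 / (ψ₁ M * M)) / (|C| + 1) := by positivity
  filter_upwards [eventually_integral_abs_lt hq ht0 htmono
    (tendsto_integral_abs_of_tendsto_integral_rpow hq hσ1 hM0 (hσ M hM0)) hε] with n hn
  by_contra! hlt
  have hgap : t (n + 2) - t n ≤ M := hlt.le.trans (le_max_left _ _)
  have h01 : t n < t (n + 1) := htmono (by lia)
  have h12 : t (n + 1) < t (n + 2) := htmono (by lia)
  have hsub : Icc (t n) (t (n + 2)) ⊆ Ici 0 := fun x hx => (ht0 n).trans hx.1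
  obtain ⟨z, hz⟩ := nonempty_Ioo.2 h01
  have hlow := lyapunov_of_three_zeros hψ₁odd hψ₂odd hψ₁mono hψ₂mono hψ₁sub hψ₂super hfcont hfodd
    hu hu1 hu2 (hq.mono hsub) (fun x hx => hode x (hsub hx)) (fun x hx => hC x (hsub hx))
    h01 h12 hgap (htz _) (htz _) (htz _)
    ⟨z, ⟨hz.1.le, (hz.2.trans h12).le⟩, htbetween n z hz⟩
  have hint : 0 ≤ ∫ s in t n..t (n + 2), |q s| :=
    intervalIntegral.integral_nonneg (h01.trans h12).le fun _ _ => abs_nonneg _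
  have hhigh := hn hgap
  rw [lt_div_iff₀ (by positivity)] at hhigh
  nlinarith [mul_le_mul_of_nonneg_right (le_abs_self C) hint]
end

section
/- Let α₁, α₂ > 0, let φ_p(s) = |s|^{p−1}·s, and let q be continuous on [a,b]. Suppose u is a nontrivial solution of the quasilinear equation (φ_{α₂}((φ_{α₁}(u'))'))' + q(x)·φ_{α₁α₂}(u) = 0 on [a,b] with u(a) = u(b) = 0, u(x) ≠ 0 for all x ∈ (a,b), and (φ_{α₁}(u'))'(ξ) = 0 for some ξ ∈ [a,b]. Then ∫ₐ^ξ q₋(x) dx + ∫_ξ^b q₊(x) dx > (2/(b−a))^{α₂(α₁+1)}. -/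
open Set

/-- The signed power `|s| ^ (p - 1) * s`. -/
noncomputable def signedPow (p s : ℝ) : ℝ := |s| ^ (p - 1) * s

theorem signedPow_zero (p : ℝ) : signedPow p 0 = 0 := by simp [signedPow]

theorem signedPow_neg (p s : ℝ) : signedPow p (-s) = -signedPow p s := by
  simp [signedPow]

theorem signedPow_of_nonneg {p s : ℝ} (hp : 0 < p) (hs : 0 ≤ s) : signedPow p s = s ^ p := by
  rcases hs.eq_or_lt with rfl | hs
  · simp [signedPow, Real.zero_rpow hp.ne']
  · rw [signedPow, abs_of_pos hs, Real.rpow_sub_one hs.ne', div_mul_cancel₀ _ hs.ne']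

theorem div_rpow_div_rpow {α₁ α₂ M H : ℝ} (hM : 0 < M) (hH : 0 < H) :
    ((M / H) ^ α₁ / H) ^ α₂ = M ^ (α₁ * α₂) * (1 / H) ^ (α₂ * (α₁ + 1)) := by
  have h : (M / H) ^ α₁ / H = M ^ α₁ * (1 / H) ^ (α₁ + 1) := by
    rw [div_eq_mul_one_div M H, Real.mul_rpow hM.le (by positivity),
      Real.rpow_add_one (by positivity)]
    ring
  rw [h, Real.mul_rpow (by positivity) (by positivity), ← Real.rpow_mul hM.le,
    ← Real.rpow_mul (by positivity), mul_comm α₂]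

/-- If `u` vanishes at an end point `e` and is critical with positive value at `c`, then somewhere
between them `φ_{α₂}((φ_{α₁}(u'))')` is very negative. -/
theorem exists_signedPow_lt_of_zero_of_critical
    {α₁ α₂ c e H : ℝ} {u u' v' : ℝ → ℝ} (hα₁ : 0 < α₁) (hα₂ : 0 < α₂)
    (hu : ∀ x, HasDerivAt u (u' x) x)
    (hv : ∀ x, HasDerivAt (fun y => signedPow α₁ (u' y)) (v' x) x)
    (hc : 0 < u c) (hc' : u' c = 0) (he : u e = 0) (hH : |c - e| ≤ H) :
    ∃ ζ ∈ uIcc c e, signedPow α₂ (v' ζ) < -(u c ^ (α₁ * α₂) * (1 / H) ^ (α₂ * (α₁ + 1))) := by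
  have hcd : Continuous u := continuous_iff_continuousAt.2 fun x => (hu x).continuousAt
  have hcv : Continuous (fun y => signedPow α₁ (u' y)) :=
    continuous_iff_continuousAt.2 fun x => (hv x).continuousAt
  have key : ∀ {d s t : ℝ}, 0 < d → 0 < s → s < d → d ≤ H → t = -((u c / d) ^ α₁ / s) →
      signedPow α₂ t < -(u c ^ (α₁ * α₂) * (1 / H) ^ (α₂ * (α₁ + 1))) := by
    intro d s t hd hs hsd hdH ht
    have hHpos : 0 < H := hd.trans_le hdH
    rw [ht, signedPow_neg, signedPow_of_nonneg hα₂ (by positivity), ← div_rpow_div_rpow hc hHpos,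
      neg_lt_neg_iff]
    apply Real.rpow_lt_rpow (by positivity) _ hα₂
    calc (u c / H) ^ α₁ / H ≤ (u c / d) ^ α₁ / d := by gcongr
      _ < (u c / d) ^ α₁ / s := by gcongr
  rcases lt_trichotomy c e with hce | rfl | hec
  · obtain ⟨η, hη, hη'⟩ := exists_hasDerivAt_eq_slope u u' hce hcd.continuousOn fun x _ => hu x
    obtain ⟨ζ, hζ, hζ'⟩ := exists_hasDerivAt_eq_slope _ v' hη.1 hcv.continuousOn fun x _ => hv x
    have hd : 0 < e - c := sub_pos.2 hce
    have hηc : u' η = -(u c / (e - c)) := by rw [hη', he]; ring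
    rw [hc', signedPow_zero, hηc, signedPow_neg,
      signedPow_of_nonneg hα₁ (by positivity)] at hζ'
    refine ⟨ζ, ?_, key hd (sub_pos.2 hη.1) (by linarith [hη.2]) ?_ (hζ'.trans (by ring))⟩
    · rw [uIcc_of_le hce.le]
      exact ⟨hζ.1.le, (hζ.2.trans hη.2).le⟩
    · rwa [abs_sub_comm, abs_of_pos hd] at hH
  · exact absurd he hc.ne'
  · obtain ⟨η, hη, hη'⟩ := exists_hasDerivAt_eq_slope u u' hec hcd.continuousOn fun x _ => hu x
    obtain ⟨ζ, hζ, hζ'⟩ := exists_hasDerivAt_eq_slope _ v' hη.2 hcv.continuousOn fun x _ => hv x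
    have hd : 0 < c - e := sub_pos.2 hec
    have hηc : u' η = u c / (c - e) := by rw [hη', he]; ring
    rw [hc', signedPow_zero, hηc, signedPow_of_nonneg hα₁ (by positivity)] at hζ'
    refine ⟨ζ, ?_, key hd (sub_pos.2 hη.2) (by linarith [hη.1]) ?_ (hζ'.trans (by ring))⟩
    · rw [uIcc_of_ge hec.le]
      exact ⟨(hη.1.trans hζ.1).le, hζ.2.le⟩
    · rwa [abs_of_pos hd] at hH

/-- A function with derivative `-q g`, where `0 ≤ g ≤ C`, that vanishes at `ξ` is bounded below in
terms of the integrals of `q₋` to the left of `ξ` and of `q₊` to its right. -/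
theorem neg_le_mul_integral_negPart_add_integral_posPart
    {a b ξ ζ C : ℝ} {q g w : ℝ → ℝ} (hq : ContinuousOn q (Icc a b))
    (hw : ∀ x ∈ Icc a b, HasDerivAt w (-(q x * g x)) x)
    (hg : ∀ x ∈ Icc a b, 0 ≤ g x ∧ g x ≤ C) (hξ : ξ ∈ Icc a b) (hwξ : w ξ = 0)
    (hζ : ζ ∈ Icc a b) :
    -w ζ ≤ C * ((∫ x in a..ξ, max (-q x) 0) + ∫ x in ξ..b, max (q x) 0) := by
  have hC : 0 ≤ C := (hg ξ hξ).1.trans (hg ξ hξ).2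
  have hqp : ContinuousOn (fun x => max (q x) 0) (Icc a b) := hq.sup continuousOn_const
  have hqm : ContinuousOn (fun x => max (-q x) 0) (Icc a b) := hq.neg.sup continuousOn_const
  have hnm : 0 ≤ ∫ x in a..ξ, max (-q x) 0 :=
    intervalIntegral.integral_nonneg hξ.1 fun x _ => le_max_right _ _
  have hnp : 0 ≤ ∫ x in ξ..b, max (q x) 0 :=
    intervalIntegral.integral_nonneg hξ.2 fun x _ => le_max_right _ _
  have hmul : ∀ (r : ℝ), ∀ x ∈ Icc a b, r * g x ≤ C * max r 0 := fun r x hx => by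
    calc r * g x ≤ max r 0 * g x :=
          mul_le_mul_of_nonneg_right (le_max_left _ _) (hg x hx).1
      _ ≤ max r 0 * C := mul_le_mul_of_nonneg_left (hg x hx).2 (le_max_right _ _)
      _ = C * max r 0 := mul_comm _ _
  rcases le_total ξ ζ with h | h
  · have hsub : Icc ξ ζ ⊆ Icc a b := Icc_subset_Icc hξ.1 hζ.2
    have h1 : -w ζ - -w ξ ≤ ∫ x in ξ..ζ, C * max (q x) 0 :=
      intervalIntegral.sub_le_integral_of_hasDeriv_right_of_le h
        (fun x hx => (hw x (hsub hx)).neg.continuousAt.continuousWithinAt)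
        (fun x hx => (hw x (hsub (Ioo_subset_Icc_self hx))).neg.hasDerivWithinAt)
        ((continuousOn_const.mul (hqp.mono hsub)).integrableOn_Icc)
        (fun x hx => by simpa using hmul (q x) x (hsub (Ioo_subset_Icc_self hx)))
    have h2 : ∫ x in ξ..ζ, max (q x) 0 ≤ ∫ x in ξ..b, max (q x) 0 :=
      intervalIntegral.integral_mono_interval le_rfl h hζ.2
        (Filter.Eventually.of_forall fun x => le_max_right _ _)
        ((hqp.mono (Icc_subset_Icc_left hξ.1)).intervalIntegrable_of_Icc hξ.2)
    rw [intervalIntegral.integral_const_mul] at h1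
    have h3 := mul_le_mul_of_nonneg_left (h2.trans (le_add_of_nonneg_left hnm)) hC
    linarith
  · have hsub : Icc ζ ξ ⊆ Icc a b := Icc_subset_Icc hζ.1 hξ.2
    have h1 : w ξ - w ζ ≤ ∫ x in ζ..ξ, C * max (-q x) 0 :=
      intervalIntegral.sub_le_integral_of_hasDeriv_right_of_le h
        (fun x hx => (hw x (hsub hx)).continuousAt.continuousWithinAt)
        (fun x hx => (hw x (hsub (Ioo_subset_Icc_self hx))).hasDerivWithinAt)
        ((continuousOn_const.mul (hqm.mono hsub)).integrableOn_Icc)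
        (fun x hx => by simpa using hmul (-q x) x (hsub (Ioo_subset_Icc_self hx)))
    have h2 : ∫ x in ζ..ξ, max (-q x) 0 ≤ ∫ x in a..ξ, max (-q x) 0 :=
      intervalIntegral.integral_mono_interval hζ.1 h le_rfl
        (Filter.Eventually.of_forall fun x => le_max_right _ _)
        ((hqm.mono (Icc_subset_Icc_right hξ.2)).intervalIntegrable_of_Icc hξ.1)
    rw [intervalIntegral.integral_const_mul] at h1
    have h3 := mul_le_mul_of_nonneg_left (h2.trans (le_add_of_nonneg_right hnp)) hC
    linarith

/-- The Lyapunov-type inequality for a solution that is positive on `(a, b)`. -/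
theorem quasilinear_two_point_of_pos
    {α₁ α₂ a b ξ : ℝ} {q u u' v' : ℝ → ℝ}
    (hα₁ : 0 < α₁) (hα₂ : 0 < α₂) (hab : a < b) (hq : ContinuousOn q (Icc a b))
    (hu : ∀ x, HasDerivAt u (u' x) x)
    (hv : ∀ x, HasDerivAt (fun y => signedPow α₁ (u' y)) (v' x) x)
    (hw : ∀ x ∈ Icc a b, HasDerivAt (fun y => signedPow α₂ (v' y))
      (-(q x * signedPow (α₁ * α₂) (u x))) x)
    (hua : u a = 0) (hub : u b = 0) (hpos : ∀ x ∈ Ioo a b, 0 < u x)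
    (hξmem : ξ ∈ Icc a b) (hξ : v' ξ = 0) :
    (2 / (b - a)) ^ (α₂ * (α₁ + 1)) <
      (∫ x in a..ξ, max (-q x) 0) + ∫ x in ξ..b, max (q x) 0 := by
  have hα : 0 < α₁ * α₂ := mul_pos hα₁ hα₂
  have hcd : Continuous u := continuous_iff_continuousAt.2 fun x => (hu x).continuousAt
  obtain ⟨c, hc, hmax⟩ := isCompact_Icc.exists_isMaxOn (nonempty_Icc.2 hab.le) hcd.continuousOn
  have hmid : (a + b) / 2 ∈ Ioo a b := ⟨by linarith, by linarith⟩
  have hM : 0 < u c := (hpos _ hmid).trans_le (hmax (Ioo_subset_Icc_self hmid))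
  have hca : a < c := hc.1.lt_of_ne (by rintro rfl; exact hM.ne' hua)
  have hcb : c < b := hc.2.lt_of_ne (by rintro rfl; exact hM.ne' hub)
  have hc' : u' c = 0 :=
    (hmax.isLocalMax (Icc_mem_nhds hca hcb)).hasDerivAt_eq_zero (hu c)
  have hnn : ∀ x ∈ Icc a b, 0 ≤ u x := fun x hx => by
    rcases eq_endpoints_or_mem_Ioo_of_mem_Icc hx with rfl | rfl | h
    exacts [hua.ge, hub.ge, (hpos x h).le]
  obtain ⟨e, he, heu, hce⟩ : ∃ e ∈ Icc a b, u e = 0 ∧ |c - e| ≤ (b - a) / 2 := by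
    rcases le_total c ((a + b) / 2) with h | h
    · exact ⟨a, left_mem_Icc.2 hab.le, hua, by rw [abs_le]; constructor <;> linarith⟩
    · exact ⟨b, right_mem_Icc.2 hab.le, hub, by rw [abs_le]; constructor <;> linarith⟩
  obtain ⟨ζ, hζ, hlt⟩ :=
    exists_signedPow_lt_of_zero_of_critical hα₁ hα₂ hu hv hM hc' heu hce
  have hle := neg_le_mul_integral_negPart_add_integral_posPart
    (g := fun x => signedPow (α₁ * α₂) (u x)) (C := u c ^ (α₁ * α₂)) hq hw
    (fun x hx => by
      rw [signedPow_of_nonneg hα (hnn x hx)]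
      exact ⟨Real.rpow_nonneg (hnn x hx) _, Real.rpow_le_rpow (hnn x hx) (hmax hx) hα.le⟩)
    hξmem (by rw [hξ, signedPow_zero]) (uIcc_subset_Icc hc he hζ)
  rw [one_div_div] at hlt
  exact lt_of_mul_lt_mul_left (by linarith) (Real.rpow_nonneg hM.le (α₁ * α₂))

theorem quasilinear_two_point
    (α₁ α₂ a b ξ : ℝ) (q u : ℝ → ℝ)
    (hα₁ : 0 < α₁) (hα₂ : 0 < α₂) (hab : a < b)
    (hq : ContinuousOn q (Icc a b))
    (hu : Differentiable ℝ u)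
    (hu1 : Differentiable ℝ (fun x => |deriv u x| ^ (α₁ - 1) * deriv u x))
    (hu2 : Differentiable ℝ (fun x =>
      |deriv (fun y => |deriv u y| ^ (α₁ - 1) * deriv u y) x| ^ (α₂ - 1) *
        deriv (fun y => |deriv u y| ^ (α₁ - 1) * deriv u y) x))
    (hode : ∀ x ∈ Icc a b,
      deriv (fun y =>
        |deriv (fun z => |deriv u z| ^ (α₁ - 1) * deriv u z) y| ^ (α₂ - 1) *
          deriv (fun z => |deriv u z| ^ (α₁ - 1) * deriv u z) y) x
        + q x * (|u x| ^ (α₁ * α₂ - 1) * u x) = 0)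
    (hua : u a = 0) (hub : u b = 0)
    (hune : ∀ x ∈ Ioo a b, u x ≠ 0)
    (hξmem : ξ ∈ Icc a b)
    (hξ : deriv (fun y => |deriv u y| ^ (α₁ - 1) * deriv u y) ξ = 0) :
    (∫ x in a..ξ, max (-q x) 0) + (∫ x in ξ..b, max (q x) 0) >
      (2 / (b - a)) ^ (α₂ * (α₁ + 1)) := by
  have hw : ∀ x ∈ Icc a b, HasDerivAt
      (fun y => signedPow α₂ (deriv (fun z => signedPow α₁ (deriv u z)) y))
      (-(q x * signedPow (α₁ * α₂) (u x))) x := fun x hx =>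
    (hu2 x).hasDerivAt.congr_deriv (eq_neg_of_add_eq_zero_left (hode x hx))
  have hsign : (∀ x ∈ Ioo a b, 0 < u x) ∨ ∀ x ∈ Ioo a b, 0 < -u x := by
    by_contra! h
    obtain ⟨⟨x, hx, hx'⟩, y, hy, hy'⟩ := h
    obtain ⟨z, hz, hz'⟩ := isPreconnected_Ioo.intermediate_value hx hy hu.continuous.continuousOn
      (show (0 : ℝ) ∈ Icc (u x) (u y) from ⟨hx', by linarith⟩)
    exact hune z hz hz'
  rcases hsign with hpos | hneg
  · exact quasilinear_two_point_of_pos hα₁ hα₂ hab hq (fun x => (hu x).hasDerivAt)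
      (fun x => (hu1 x).hasDerivAt) hw hua hub hpos hξmem hξ
  · refine quasilinear_two_point_of_pos (u := fun x => -u x) (u' := fun x => -deriv u x)
      (v' := fun x => -deriv (fun z => signedPow α₁ (deriv u z)) x) hα₁ hα₂ hab hq
      (fun x => (hu x).hasDerivAt.neg) (fun x => ?_) (fun x hx => ?_) (by simp [hua])
      (by simp [hub]) hneg hξmem (neg_eq_zero.2 hξ)
    · simp only [signedPow_neg]
      exact (hu1 x).hasDerivAt.neg
    · simp only [signedPow_neg, mul_neg]
      exact (hw x hx).neg
end

section
/- Let q be continuous on [a,b]. Suppose u is a nontrivial solution of the third order linear equation u''' + q(x)·u = 0 on [a,b], and t₁ < t₂ < ⋯ < t_{2N+1} (N ∈ ℕ, N ≥ 1) are zeros of u in [a,b] with u(x) ≠ 0 between consecutive zeros. Then Σ_{k=1}^{N} max_{ξ_k ∈ [t_{2k−1}, t_{2k+1}]} { ∫_{t_{2k−1}}^{ξ_k} q₋(x) dx + ∫_{ξ_k}^{t_{2k+1}} q₊(x) dx } > 4N³/(b−a)². -/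
open Set

theorem arch_bound_of_pos {α β d : ℝ} {q u v w : ℝ → ℝ} (hαβ : α < β)
    (hq : ContinuousOn q (Icc α β))
    (hu : ∀ x, HasDerivAt u (v x) x) (hv : ∀ x, HasDerivAt v (w x) x)
    (hw : ∀ x ∈ Icc α β, HasDerivAt w (-(q x * u x)) x)
    (huα : u α = 0) (huβ : u β = 0) (hpos : ∀ x ∈ Ioo α β, 0 < u x)
    (hd : d ∈ Icc α β) (hwd : w d = 0) :
    8 / (β - α) ^ 2 ≤ (∫ x in α..d, max (-q x) 0) + ∫ x in d..β, max (q x) 0 := by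
  have hucont : Continuous u := continuous_iff_continuousAt.2 fun x => (hu x).continuousAt
  have hqneg : ContinuousOn (fun x => max (-q x) 0) (Icc α β) := hq.neg.sup continuousOn_const
  have hqpos : ContinuousOn (fun x => max (q x) 0) (Icc α β) := hq.sup continuousOn_const
  have integrable {f : ℝ → ℝ} (hf : ContinuousOn f (Icc α β)) {x y : ℝ}
      (hx : x ∈ Icc α β) (hy : y ∈ Icc α β) : IntervalIntegrable f MeasureTheory.volume x y :=
    (hf.mono (uIcc_subset_Icc hx hy)).intervalIntegrable
  have hαmem : α ∈ Icc α β := left_mem_Icc.2 hαβ.le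
  have hβmem : β ∈ Icc α β := right_mem_Icc.2 hαβ.le
  obtain ⟨c, hc, hmax⟩ := isCompact_Icc.exists_isMaxOn ⟨α, hαmem⟩ hucont.continuousOn
  set M := u c with hM
  set A := ∫ x in α..d, max (-q x) 0 with hA
  set B := ∫ x in d..β, max (q x) 0 with hB
  have hnonneg : ∀ x ∈ Icc α β, 0 ≤ u x := by
    intro x hx
    rcases hx.1.eq_or_lt with h | h
    · exact (h ▸ huα).ge
    rcases hx.2.eq_or_lt with h' | h'
    · exact (h' ▸ huβ).ge
    · exact (hpos x ⟨h, h'⟩).le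
  have hMpos : 0 < M := by
    have hmid : (α + β) / 2 ∈ Ioo α β := ⟨by linarith, by linarith⟩
    exact (hpos _ hmid).trans_le (hmax (Ioo_subset_Icc_self hmid))
  have hA0 : 0 ≤ A := intervalIntegral.integral_nonneg hd.1 fun _ _ => le_max_right _ _
  have hB0 : 0 ≤ B := intervalIntegral.integral_nonneg hd.2 fun _ _ => le_max_right _ _
  have hrhs : ContinuousOn (fun x => -(q x * u x)) (Icc α β) :=
    (hq.mul hucont.continuousOn).neg
  have hftc {x y : ℝ} (hx : x ∈ Icc α β) (hy : y ∈ Icc α β) :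
      ∫ s in x..y, -(q s * u s) = w y - w x :=
    intervalIntegral.integral_eq_sub_of_hasDerivAt
      (fun s hs => hw s (uIcc_subset_Icc hx hy hs)) (integrable hrhs hx hy)
  have hlower : ∀ x ∈ Icc α β, -(M * (A + B)) ≤ w x := by
    intro x hx
    rcases le_total d x with hdx | hxd
    · have h1 : ∫ s in d..x, -(M * max (q s) 0) ≤ ∫ s in d..x, -(q s * u s) := by
        refine intervalIntegral.integral_mono_on hdx (integrable (hqpos.const_mul M).neg hd hx)
          (integrable hrhs hd hx) fun s hs => ?_
        have hs' : s ∈ Icc α β := ⟨hd.1.trans hs.1, hs.2.trans hx.2⟩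
        have : u s ≤ M := hmax hs'
        have := mul_le_mul_of_nonneg_right (le_max_left (q s) 0) (hnonneg s hs')
        have := mul_le_mul_of_nonneg_right ‹u s ≤ M› (le_max_right (q s) 0)
        linarith
      have h2 : ∫ s in d..x, max (q s) 0 ≤ B := by
        rw [hB, ← intervalIntegral.integral_add_adjacent_intervals (integrable hqpos hd hx)
          (integrable hqpos hx hβmem)]
        exact le_add_of_nonneg_right
          (intervalIntegral.integral_nonneg hx.2 fun _ _ => le_max_right _ _)
      rw [hftc hd hx, intervalIntegral.integral_neg, intervalIntegral.integral_const_mul] at h1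
      nlinarith
    · have h1 : ∫ s in x..d, -(q s * u s) ≤ ∫ s in x..d, M * max (-q s) 0 := by
        refine intervalIntegral.integral_mono_on hxd (integrable hrhs hx hd)
          (integrable (hqneg.const_mul M) hx hd) fun s hs => ?_
        have hs' : s ∈ Icc α β := ⟨hx.1.trans hs.1, hs.2.trans hd.2⟩
        have : u s ≤ M := hmax hs'
        have := mul_le_mul_of_nonneg_right (le_max_left (-q s) 0) (hnonneg s hs')
        have := mul_le_mul_of_nonneg_right ‹u s ≤ M› (le_max_right (-q s) 0)
        linarith
      have h2 : ∫ s in x..d, max (-q s) 0 ≤ A := by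
        rw [hA, ← intervalIntegral.integral_add_adjacent_intervals (integrable hqneg hαmem hx)
          (integrable hqneg hx hd)]
        exact le_add_of_nonneg_left
          (intervalIntegral.integral_nonneg hx.1 fun _ _ => le_max_right _ _)
      rw [hftc hx hd, intervalIntegral.integral_const_mul] at h1
      nlinarith
  have hg (x : ℝ) : HasDerivAt (fun y => u y + M * (A + B) / 2 * ((y - α) * (y - β)))
      (v x + M * (A + B) / 2 * ((x - α) + (x - β))) x := by
    have h1 : HasDerivAt (fun y => y - α) 1 x := (hasDerivAt_id x).sub_const α
    have h2 : HasDerivAt (fun y => y - β) 1 x := (hasDerivAt_id x).sub_const β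
    exact ((hu x).add ((h1.mul h2).const_mul (M * (A + B) / 2))).congr_deriv (by ring)
  have hg' (x : ℝ) : HasDerivAt (fun y => v y + M * (A + B) / 2 * ((y - α) + (y - β)))
      (w x + M * (A + B)) x := by
    have h1 : HasDerivAt (fun y => y - α) 1 x := (hasDerivAt_id x).sub_const α
    have h2 : HasDerivAt (fun y => y - β) 1 x := (hasDerivAt_id x).sub_const β
    exact ((hv x).add ((h1.add h2).const_mul (M * (A + B) / 2))).congr_deriv (by ring)
  have hconv : ConvexOn ℝ (Icc α β) (fun y => u y + M * (A + B) / 2 * ((y - α) * (y - β))) := by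
    refine convexOn_of_hasDerivWithinAt2_nonneg (convex_Icc α β)
      (fun x _ => (hg x).continuousAt.continuousWithinAt)
      (fun x _ => (hg x).hasDerivWithinAt) (fun x _ => (hg' x).hasDerivWithinAt) fun x hx => ?_
    linarith [hlower x (interior_subset hx)]
  have hle := hconv.le_max_of_mem_Icc hαmem hβmem hc
  simp only [huα, huβ, sub_self, zero_mul, mul_zero, add_zero, max_self] at hle
  have hP : 0 ≤ M * (A + B) := by positivity
  have hfinal : M * 8 ≤ M * ((A + B) * (β - α) ^ 2) := by
    nlinarith [mul_nonneg hP (sq_nonneg (2 * c - α - β))]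
  rw [div_le_iff₀ (pow_pos (sub_pos.2 hαβ) 2)]
  exact le_of_mul_le_mul_left hfinal hMpos

theorem arch_bound {α β d : ℝ} {q u v w : ℝ → ℝ} (hαβ : α < β)
    (hq : ContinuousOn q (Icc α β))
    (hu : ∀ x, HasDerivAt u (v x) x) (hv : ∀ x, HasDerivAt v (w x) x)
    (hw : ∀ x ∈ Icc α β, HasDerivAt w (-(q x * u x)) x)
    (huα : u α = 0) (huβ : u β = 0) (hne : ∀ x ∈ Ioo α β, u x ≠ 0)
    (hd : d ∈ Icc α β) (hwd : w d = 0) :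
    8 / (β - α) ^ 2 ≤ (∫ x in α..d, max (-q x) 0) + ∫ x in d..β, max (q x) 0 := by
  by_cases hpos : ∀ x ∈ Ioo α β, 0 < u x
  · exact arch_bound_of_pos hαβ hq hu hv hw huα huβ hpos hd hwd
  push Not at hpos
  obtain ⟨x, hx, hux⟩ := hpos
  refine arch_bound_of_pos (u := fun x => -u x) (v := fun x => -v x) (w := fun x => -w x) hαβ hq
    (fun y => (hu y).neg) (fun y => (hv y).neg)
    (fun y hy => (hw y hy).neg.congr_deriv (by ring)) (by simp [huα]) (by simp [huβ])
    (fun y hy => ?_) hd (by simp [hwd])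
  by_contra! hle
  have hcont : ContinuousOn u (Ioo α β) := fun z _ => (hu z).continuousAt.continuousWithinAt
  obtain ⟨z, hz, hz0⟩ := isPreconnected_Ioo.intermediate_value hx hy hcont
    (show (0 : ℝ) ∈ Icc (u x) (u y) from ⟨hux, by linarith⟩)
  exact hne z hz hz0

theorem three_zeros_bound {t₁ t₂ t₃ : ℝ} {q u v w : ℝ → ℝ} (h₁₂ : t₁ < t₂) (h₂₃ : t₂ < t₃)
    (hq : ContinuousOn q (Icc t₁ t₃))
    (hu : ∀ x, HasDerivAt u (v x) x) (hv : ∀ x, HasDerivAt v (w x) x)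
    (hw : ∀ x ∈ Icc t₁ t₃, HasDerivAt w (-(q x * u x)) x)
    (hu₁ : u t₁ = 0) (hu₂ : u t₂ = 0) (hu₃ : u t₃ = 0)
    (hne₁₂ : ∀ x ∈ Ioo t₁ t₂, u x ≠ 0) (hne₂₃ : ∀ x ∈ Ioo t₂ t₃, u x ≠ 0) :
    ∃ ξ ∈ Icc t₁ t₃, 4 / (t₃ - t₁) ^ 2 <
      (∫ x in t₁..ξ, max (-q x) 0) + ∫ x in ξ..t₃, max (q x) 0 := by
  have hucont : Continuous u := continuous_iff_continuousAt.2 fun x => (hu x).continuousAt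
  have hvcont : Continuous v := continuous_iff_continuousAt.2 fun x => (hv x).continuousAt
  obtain ⟨x, hx, hvx⟩ := exists_hasDerivAt_eq_zero h₁₂ hucont.continuousOn (hu₁.trans hu₂.symm)
    fun x _ => hu x
  obtain ⟨y, hy, hvy⟩ := exists_hasDerivAt_eq_zero h₂₃ hucont.continuousOn (hu₂.trans hu₃.symm)
    fun x _ => hu x
  obtain ⟨d, hd, hwd⟩ := exists_hasDerivAt_eq_zero (hx.2.trans hy.1) hvcont.continuousOn
    (hvx.trans hvy.symm) fun x _ => hv x
  have hd₁ : t₁ < d := hx.1.trans hd.1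
  have hd₃ : d < t₃ := hd.2.trans hy.2
  refine ⟨d, ⟨hd₁.le, hd₃.le⟩, ?_⟩
  have integrable {f : ℝ → ℝ} (hf : ContinuousOn f (Icc t₁ t₃)) {x y : ℝ}
      (hx : x ∈ Icc t₁ t₃) (hy : y ∈ Icc t₁ t₃) : IntervalIntegrable f MeasureTheory.volume x y :=
    (hf.mono (uIcc_subset_Icc hx hy)).intervalIntegrable
  have hqneg : ContinuousOn (fun x => max (-q x) 0) (Icc t₁ t₃) := hq.neg.sup continuousOn_const
  have hqpos : ContinuousOn (fun x => max (q x) 0) (Icc t₁ t₃) := hq.sup continuousOn_const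
  have hm₁ : t₁ ∈ Icc t₁ t₃ := ⟨le_rfl, (h₁₂.trans h₂₃).le⟩
  have hm₂ : t₂ ∈ Icc t₁ t₃ := ⟨h₁₂.le, h₂₃.le⟩
  have hm₃ : t₃ ∈ Icc t₁ t₃ := ⟨(h₁₂.trans h₂₃).le, le_rfl⟩
  have hmd : d ∈ Icc t₁ t₃ := ⟨hd₁.le, hd₃.le⟩
  have hlen {l : ℝ} (hl : 0 < l) (hl' : l ≤ t₃ - t₁) : 4 / (t₃ - t₁) ^ 2 < 8 / l ^ 2 :=
    div_lt_div₀ (by norm_num) (by gcongr) (by norm_num) (by positivity)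
  rcases le_total d t₂ with h | h
  · have hsub : Icc t₁ t₂ ⊆ Icc t₁ t₃ := Icc_subset_Icc_right h₂₃.le
    have key := arch_bound h₁₂ (hq.mono hsub) hu hv (fun x hx => hw x (hsub hx)) hu₁ hu₂ hne₁₂
      ⟨hd₁.le, h⟩ hwd
    rw [← intervalIntegral.integral_add_adjacent_intervals (integrable hqpos hmd hm₂)
      (integrable hqpos hm₂ hm₃)]
    have : 0 ≤ ∫ x in t₂..t₃, max (q x) 0 :=
      intervalIntegral.integral_nonneg h₂₃.le fun _ _ => le_max_right _ _
    linarith [hlen (sub_pos.2 h₁₂) (by linarith)]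
  · have hsub : Icc t₂ t₃ ⊆ Icc t₁ t₃ := Icc_subset_Icc_left h₁₂.le
    have key := arch_bound h₂₃ (hq.mono hsub) hu hv (fun x hx => hw x (hsub hx)) hu₂ hu₃ hne₂₃
      ⟨h, hd₃.le⟩ hwd
    rw [← intervalIntegral.integral_add_adjacent_intervals (integrable hqneg hm₁ hm₂)
      (integrable hqneg hm₂ hmd)]
    have : 0 ≤ ∫ x in t₁..t₂, max (-q x) 0 :=
      intervalIntegral.integral_nonneg h₁₂.le fun _ _ => le_max_right _ _
    linarith [hlen (sub_pos.2 h₂₃) (by linarith)]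

theorem card_pow_three_div_sq_le_sum {ι : Type*} {s : Finset ι} {l : ι → ℝ} {L : ℝ}
    (hs : s.Nonempty) (hL : 0 < L) (hl : ∀ i ∈ s, 0 < l i) (hsum : ∑ i ∈ s, l i ≤ L) :
    (s.card : ℝ) ^ 3 / L ^ 2 ≤ ∑ i ∈ s, 1 / l i ^ 2 := by
  have hn : (0 : ℝ) < s.card := by exact_mod_cast hs.card_pos
  set h := L / s.card with hh
  have hpos : 0 < h := div_pos hL hn
  have htangent : ∀ i ∈ s, 3 / h ^ 2 - 2 / h ^ 3 * l i ≤ 1 / l i ^ 2 := by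
    intro i hi
    have hli := hl i hi
    have heq : 1 / l i ^ 2 - (3 / h ^ 2 - 2 / h ^ 3 * l i)
        = (h - l i) ^ 2 * (h + 2 * l i) / (h ^ 3 * l i ^ 2) := by
      field_simp
      ring
    have : 0 ≤ (h - l i) ^ 2 * (h + 2 * l i) / (h ^ 3 * l i ^ 2) := by positivity
    linarith
  refine le_trans ?_ (Finset.sum_le_sum htangent)
  rw [Finset.sum_sub_distrib, ← Finset.mul_sum, Finset.sum_const, nsmul_eq_mul]
  have h1 : 2 / h ^ 3 * ∑ i ∈ s, l i ≤ 2 / h ^ 3 * L := by gcongr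
  have h2 : (s.card : ℝ) ^ 3 / L ^ 2 = s.card * (3 / h ^ 2) - 2 / h ^ 3 * L := by
    rw [hh]
    field_simp
    ring
  linarith

theorem linear_zero_count
    (a b : ℝ) (q u : ℝ → ℝ) (N : ℕ) (t : ℕ → ℝ)
    (hab : a < b) (hN : 1 ≤ N)
    (hq : ContinuousOn q (Icc a b))
    (hu : Differentiable ℝ u)
    (hu1 : Differentiable ℝ (deriv u))
    (hu2 : Differentiable ℝ (deriv (deriv u)))
    (hode : ∀ x ∈ Icc a b, deriv (deriv (deriv u)) x + q x * u x = 0)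
    (hnontriv : ∃ x ∈ Icc a b, u x ≠ 0)
    (htmem : ∀ k, 1 ≤ k → k ≤ 2 * N + 1 → t k ∈ Icc a b)
    (htmono : ∀ k, 1 ≤ k → k < 2 * N + 1 → t k < t (k + 1))
    (htz : ∀ k, 1 ≤ k → k ≤ 2 * N + 1 → u (t k) = 0)
    (htbetween : ∀ k, 1 ≤ k → k < 2 * N + 1 →
      ∀ x ∈ Ioo (t k) (t (k + 1)), u x ≠ 0) :
    ∃ ξ : ℕ → ℝ,
      (∀ k ∈ Finset.Icc 1 N, ξ k ∈ Icc (t (2 * k - 1)) (t (2 * k + 1))) ∧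
      4 * (N : ℝ) ^ 3 / (b - a) ^ 2 <
        ∑ k ∈ Finset.Icc 1 N,
          ((∫ x in t (2 * k - 1)..ξ k, max (-q x) 0) +
            (∫ x in ξ k..t (2 * k + 1), max (q x) 0)) := by
  have hstep : ∀ k ∈ Finset.Icc 1 N,
      t (2 * k - 1) < t (2 * k) ∧ t (2 * k) < t (2 * k + 1) := by
    intro k hk
    rw [Finset.mem_Icc] at hk
    have h := htmono (2 * k - 1) (by omega) (by omega)
    rw [Nat.sub_add_cancel (by omega)] at h
    exact ⟨h, htmono (2 * k) (by omega) (by omega)⟩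
  have hlocal : ∀ k, ∃ ξ, k ∈ Finset.Icc 1 N → ξ ∈ Icc (t (2 * k - 1)) (t (2 * k + 1)) ∧
      4 / (t (2 * k + 1) - t (2 * k - 1)) ^ 2 <
        (∫ x in t (2 * k - 1)..ξ, max (-q x) 0) + ∫ x in ξ..t (2 * k + 1), max (q x) 0 := by
    intro k
    by_cases hk : k ∈ Finset.Icc 1 N
    swap
    · exact ⟨0, fun h => absurd h hk⟩
    obtain ⟨h₁₂, h₂₃⟩ := hstep k hk
    rw [Finset.mem_Icc] at hk
    have hsub : Icc (t (2 * k - 1)) (t (2 * k + 1)) ⊆ Icc a b :=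
      Icc_subset_Icc (htmem _ (by omega) (by omega)).1 (htmem _ (by omega) (by omega)).2
    have hne := htbetween (2 * k - 1) (by omega) (by omega)
    rw [Nat.sub_add_cancel (by omega)] at hne
    obtain ⟨ξ, hξ, hlt⟩ := three_zeros_bound h₁₂ h₂₃ (hq.mono hsub)
      (fun x => (hu x).hasDerivAt) (fun x => (hu1 x).hasDerivAt)
      (fun x hx => (hu2 x).hasDerivAt.congr_deriv (by linarith [hode x (hsub hx)]))
      (htz _ (by omega) (by omega)) (htz _ (by omega) (by omega)) (htz _ (by omega) (by omega))
      hne (htbetween (2 * k) (by omega) (by omega))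
    exact ⟨ξ, fun _ => ⟨hξ, hlt⟩⟩
  choose ξ hξ using hlocal
  refine ⟨ξ, fun k hk => (hξ k hk).1, ?_⟩
  have hne : (Finset.Icc 1 N).Nonempty := Finset.nonempty_Icc.2 hN
  refine lt_of_le_of_lt ?_ (Finset.sum_lt_sum_of_nonempty hne fun k hk => (hξ k hk).2)
  have htel : ∀ n, ∑ k ∈ Finset.Icc 1 n, (t (2 * k + 1) - t (2 * k - 1)) = t (2 * n + 1) - t 1 := by
    intro n
    induction n with
    | zero => simp
    | succ n ih =>
      rw [Finset.sum_Icc_succ_top (by omega), ih, show 2 * (n + 1) - 1 = 2 * n + 1 by omega]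
      ring
  have hsum : ∑ k ∈ Finset.Icc 1 N, (t (2 * k + 1) - t (2 * k - 1)) ≤ b - a := by
    rw [htel]
    linarith [(htmem (2 * N + 1) (by omega) le_rfl).2, (htmem 1 le_rfl (by omega)).1]
  have hpower := card_pow_three_div_sq_le_sum hne (sub_pos.2 hab)
    (fun k hk => sub_pos.2 ((hstep k hk).1.trans (hstep k hk).2)) hsum
  rw [Nat.card_Icc, Nat.add_sub_cancel] at hpower
  calc 4 * (N : ℝ) ^ 3 / (b - a) ^ 2 = 4 * ((N : ℝ) ^ 3 / (b - a) ^ 2) := by ring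
    _ ≤ 4 * ∑ k ∈ Finset.Icc 1 N, 1 / (t (2 * k + 1) - t (2 * k - 1)) ^ 2 := by gcongr
    _ = ∑ k ∈ Finset.Icc 1 N, 4 / (t (2 * k + 1) - t (2 * k - 1)) ^ 2 := by
      rw [Finset.mul_sum]
      exact Finset.sum_congr rfl fun k _ => by ring
end

section
/- (Lyapunov's inequality) Let q be continuous on [a,b] with a < b, and suppose u is a nontrivial solution of u'' + q(x)·u = 0 on [a,b] with u(a) = u(b) = 0 and u(x) ≠ 0 for all x ∈ (a,b). Then ∫ₐ^b |q(x)| dx > 4/(b−a). -/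
open Set

/-- At an interior point where `|u|` is maximal and positive, the derivative of `u` vanishes. -/
lemma deriv_eq_zero_of_abs_le {u : ℝ → ℝ} (hu : Differentiable ℝ u) {a b x : ℝ}
    (hx : x ∈ Ioo a b) (hpos : 0 < |u x|) (hmax : ∀ y ∈ Icc a b, |u y| ≤ |u x|) :
    deriv u x = 0 := by
  have hloc : IsLocalMax (fun y => u y ^ 2) x := by
    filter_upwards [Icc_mem_nhds hx.1 hx.2] with y hy
    exact sq_le_sq.mpr (hmax y hy)
  have h := hloc.hasDerivAt_eq_zero ((hu x).hasDerivAt.pow 2)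
  simpa [abs_pos.mp hpos] using h

/-- If `u` solves `u'' + q u = 0` on `[a, b]`, vanishes at `a` and `b`, and is not identically
zero, then somewhere `|q|` is nonzero while `|u|` is below its maximum. -/
lemma exists_abs_mul_lt {a b c : ℝ} {q u : ℝ → ℝ}
    (hu : Differentiable ℝ u) (hu1 : Differentiable ℝ (deriv u))
    (hode : ∀ x ∈ Icc a b, deriv (deriv u) x + q x * u x = 0)
    (hua : u a = 0) (hub : u b = 0) (hc : c ∈ Ioo a b) (hpos : 0 < |u c|)
    (hmax : ∀ y ∈ Icc a b, |u y| ≤ |u c|) :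
    ∃ x ∈ Icc a b, |q x| * |u x| < |q x| * |u c| := by
  by_contra! hle
  have hprod : ∀ x ∈ Icc a b, q x = 0 ∨ deriv u x = 0 := by
    intro x hx
    by_cases hqx : q x = 0
    · exact Or.inl hqx
    right
    have heq : |u x| = |u c| :=
      (hmax x hx).antisymm (le_of_mul_le_mul_left (hle x hx) (abs_pos.mpr hqx))
    have hux : u x ≠ 0 := abs_pos.mp (heq ▸ hpos)
    have hxa : a ≠ x := fun h => hux (h ▸ hua)
    have hxb : x ≠ b := fun h => hux (h ▸ hub)
    exact deriv_eq_zero_of_abs_le hu ⟨hx.1.lt_of_ne hxa, hx.2.lt_of_ne hxb⟩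
      (abs_pos.mpr hux) (heq ▸ hmax)
  have hder : ∀ x, HasDerivAt (fun y => deriv u y ^ 2)
      (2 * deriv u x * deriv (deriv u) x) x := fun x => by
    have h := (hu1 x).hasDerivAt.pow 2
    norm_num at h
    exact h
  have hconst := constant_of_has_deriv_right_zero (a := a) (b := b)
    (f := fun y => deriv u y ^ 2) (fun x _ => (hder x).continuousAt.continuousWithinAt)
    (fun x hx => by
      have hx' := Ico_subset_Icc_self hx
      have h0 : 2 * deriv u x * deriv (deriv u) x = 0 := by
        rw [eq_neg_of_add_eq_zero_left (hode x hx')]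
        rcases hprod x hx' with h | h <;> simp [h]
      exact h0 ▸ (hder x).hasDerivWithinAt)
  have huc := deriv_eq_zero_of_abs_le hu hc hpos hmax
  have hzero : ∀ x ∈ Icc a b, deriv u x = 0 := by
    intro x hx
    have h := (hconst x hx).trans (hconst c (Ioo_subset_Icc_self hc)).symm
    simpa [huc] using h
  obtain ⟨y, hy, hslope⟩ := exists_deriv_eq_slope u hc.1 hu.continuous.continuousOn
    hu.differentiableOn
  rw [hzero y ⟨hy.1.le, (hy.2.trans hc.2).le⟩, hua, sub_zero, eq_comm,
    div_eq_zero_iff] at hslope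
  exact hslope.elim (abs_pos.mp hpos) (sub_pos.mpr hc.1).ne'

/-- A function vanishing at `a` and `b` has slopes in `(a, b)` differing by at least
`4 |u c| / (b - a)`. -/
lemma exists_four_mul_abs_div_le_abs_deriv_sub {a b c : ℝ} {u : ℝ → ℝ}
    (hu : Differentiable ℝ u) (hua : u a = 0) (hub : u b = 0) (hc : c ∈ Ioo a b) :
    ∃ s t, a ≤ s ∧ s ≤ t ∧ t ≤ b ∧ 4 / (b - a) * |u c| ≤ |deriv u t - deriv u s| := by
  obtain ⟨s, hs, hs'⟩ := exists_deriv_eq_slope u hc.1 hu.continuous.continuousOn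
    hu.differentiableOn
  obtain ⟨t, ht, ht'⟩ := exists_deriv_eq_slope u hc.2 hu.continuous.continuousOn
    hu.differentiableOn
  refine ⟨s, t, hs.1.le, (hs.2.trans ht.1).le, ht.2.le, ?_⟩
  have h1 : 0 < c - a := sub_pos.mpr hc.1
  have h2 : 0 < b - c := sub_pos.mpr hc.2
  have h3 : 0 < b - a := by linarith
  have heq : deriv u t - deriv u s = -((b - a) / ((c - a) * (b - c)) * u c) := by
    rw [hs', ht', hua, hub]
    field_simp
    ring
  rw [heq, abs_neg, abs_mul, abs_of_pos (by positivity : 0 < (b - a) / ((c - a) * (b - c)))]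
  refine mul_le_mul_of_nonneg_right ?_ (abs_nonneg _)
  rw [div_le_div_iff₀ h3 (by positivity)]
  nlinarith [sq_nonneg ((c - a) - (b - c))]

theorem lyapunov_classical
    (a b : ℝ) (q u : ℝ → ℝ)
    (hab : a < b)
    (hq : ContinuousOn q (Icc a b))
    (hu : Differentiable ℝ u)
    (hu1 : Differentiable ℝ (deriv u))
    (hode : ∀ x ∈ Icc a b, deriv (deriv u) x + q x * u x = 0)
    (hua : u a = 0) (hub : u b = 0)
    (hune : ∀ x ∈ Ioo a b, u x ≠ 0) :
    (∫ x in a..b, |q x|) > 4 / (b - a) := by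
  obtain ⟨c, hcmem, hmax⟩ := isCompact_Icc.exists_isMaxOn (nonempty_Icc.mpr hab.le)
    hu.continuous.abs.continuousOn
  replace hmax : ∀ y ∈ Icc a b, |u y| ≤ |u c| := fun y hy => hmax hy
  obtain ⟨m, hm⟩ := exists_between hab
  have hpos : 0 < |u c| :=
    (abs_pos.mpr (hune m hm)).trans_le (hmax m (Ioo_subset_Icc_self hm))
  have huc : u c ≠ 0 := abs_pos.mp hpos
  have hc : c ∈ Ioo a b :=
    ⟨hcmem.1.lt_of_ne fun h => huc (h ▸ hua), hcmem.2.lt_of_ne fun h => huc (h ▸ hub)⟩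
  obtain ⟨s, t, has, hst, htb, hslope⟩ :=
    exists_four_mul_abs_div_le_abs_deriv_sub hu hua hub hc
  have hsub : Icc s t ⊆ Icc a b := Icc_subset_Icc has htb
  have hqu : ContinuousOn (fun x => q x * u x) (Icc a b) := hq.mul hu.continuous.continuousOn
  have hftc : ∫ x in s..t, -(q x * u x) = deriv u t - deriv u s := by
    refine intervalIntegral.integral_eq_sub_of_hasDerivAt (fun x hx => ?_)
      ((hqu.mono hsub).neg.intervalIntegrable_of_Icc hst)
    rw [uIcc_of_le hst] at hx
    rw [← eq_neg_of_add_eq_zero_left (hode x (hsub hx))]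
    exact (hu1 x).hasDerivAt
  have hupper : |deriv u t - deriv u s| ≤ ∫ x in a..b, |q x| * |u x| := by
    simp_rw [← abs_mul]
    calc |deriv u t - deriv u s| = |∫ x in s..t, q x * u x| := by
          rw [← hftc, intervalIntegral.integral_neg, abs_neg]
      _ ≤ ∫ x in s..t, |q x * u x| := intervalIntegral.abs_integral_le_integral_abs hst
      _ ≤ ∫ x in a..b, |q x * u x| :=
          intervalIntegral.integral_mono_interval has hst htb
            (Filter.Eventually.of_forall fun x => abs_nonneg _)
            (hqu.abs.intervalIntegrable_of_Icc hab.le)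
  have hstrict : ∫ x in a..b, |q x| * |u x| < ∫ x in a..b, |q x| * |u c| :=
    intervalIntegral.integral_lt_integral_of_continuousOn_of_le_of_exists_lt hab
      (hq.abs.mul hu.continuous.abs.continuousOn) (hq.abs.mul continuousOn_const)
      (fun x hx => mul_le_mul_of_nonneg_left (hmax x (Ioc_subset_Icc_self hx)) (abs_nonneg _))
      (exists_abs_mul_lt hu hu1 hode hua hub hc hpos hmax)
  rw [intervalIntegral.integral_mul_const] at hstrict
  exact lt_of_mul_lt_mul_right (hslope.trans_lt (hupper.trans_lt hstrict)) hpos.le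
end

section
/- (Parhi–Panigrahi, two-point case) Let q be continuous on [a,b] with a < b, and suppose u is a nontrivial solution of u''' + q(x)·u = 0 on [a,b] with u(a) = u(b) = 0, u(x) ≠ 0 for all x ∈ (a,b), and u''(ξ) = 0 for some ξ ∈ [a,b]. Then ∫ₐ^b |q(x)| dx > 4/(b−a)². -/
open Set

/-- A function vanishing at both endpoints of `[a, b]` whose second derivative is bounded below by
`-B` is at most `B (b - a)² / 8`. -/
lemma le_of_neg_le_deriv_deriv {a b B : ℝ} {f : ℝ → ℝ} (hab : a ≤ b) (hB : 0 ≤ B)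
    (hf : Differentiable ℝ f) (hf1 : Differentiable ℝ (deriv f))
    (hfa : f a = 0) (hfb : f b = 0)
    (hf2 : ∀ x ∈ Icc a b, -B ≤ deriv (deriv f) x) {x : ℝ} (hx : x ∈ Icc a b) :
    f x ≤ B * (b - a) ^ 2 / 8 := by
  have h1 : ∀ y, HasDerivAt (fun t => f t + B / 2 * ((t - a) * (t - b)))
      (deriv f y + B / 2 * ((y - b) + (y - a))) y := fun y => by
    have h := (hf y).hasDerivAt.add
      ((((hasDerivAt_id y).sub_const a).mul ((hasDerivAt_id y).sub_const b)).const_mul (B / 2))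
    exact h.congr_deriv (by simp)
  have h2 : ∀ y, HasDerivAt (fun t => deriv f t + B / 2 * ((t - b) + (t - a)))
      (deriv (deriv f) y + B) y := fun y => by
    have h := (hf1 y).hasDerivAt.add
      ((((hasDerivAt_id y).sub_const b).add ((hasDerivAt_id y).sub_const a)).const_mul (B / 2))
    exact h.congr_deriv (by ring)
  have hconv : ConvexOn ℝ (Icc a b) (fun t => f t + B / 2 * ((t - a) * (t - b))) :=
    convexOn_of_hasDerivWithinAt2_nonneg (convex_Icc a b)
      (fun y _ => (h1 y).continuousAt.continuousWithinAt)
      (fun y _ => (h1 y).hasDerivWithinAt) (fun y _ => (h2 y).hasDerivWithinAt)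
      (fun y hy => by linarith [hf2 y (interior_subset hy)])
  have hle := hconv.le_max_of_mem_Icc (left_mem_Icc.2 hab) (right_mem_Icc.2 hab) hx
  simp only [hfa, hfb, sub_self, zero_mul, mul_zero, add_zero, max_self] at hle
  nlinarith [mul_nonneg hB (sq_nonneg (2 * x - a - b))]

theorem parhi_panigrahi_two_point
    (a b ξ : ℝ) (q u : ℝ → ℝ)
    (hab : a < b)
    (hq : ContinuousOn q (Icc a b))
    (hu : Differentiable ℝ u)
    (hu1 : Differentiable ℝ (deriv u))
    (hu2 : Differentiable ℝ (deriv (deriv u)))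
    (hode : ∀ x ∈ Icc a b, deriv (deriv (deriv u)) x + q x * u x = 0)
    (hua : u a = 0) (hub : u b = 0)
    (hune : ∀ x ∈ Ioo a b, u x ≠ 0)
    (hξmem : ξ ∈ Icc a b)
    (hξ : deriv (deriv u) ξ = 0) :
    (∫ x in a..b, |q x|) > 4 / (b - a) ^ 2 := by
  obtain ⟨c, hc, hmax⟩ := isCompact_Icc.exists_isMaxOn (nonempty_Icc.2 hab.le)
    (hu.continuous.abs.continuousOn (s := Icc a b))
  have hM : ∀ x ∈ Icc a b, |u x| ≤ |u c| := fun x hx => hmax hx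
  have hMpos : 0 < |u c| := by
    have hm : (a + b) / 2 ∈ Ioo a b := ⟨by linarith, by linarith⟩
    exact (abs_pos.2 (hune _ hm)).trans_le (hM _ (Ioo_subset_Icc_self hm))
  have hK : 0 ≤ ∫ x in a..b, |q x| :=
    intervalIntegral.integral_nonneg hab.le fun x _ => abs_nonneg _
  have hcont : ContinuousOn (deriv (deriv (deriv u))) (Icc a b) :=
    (hq.mul hu.continuous.continuousOn).neg.congr fun x hx => by
      simpa using eq_neg_of_add_eq_zero_left (hode x hx)
  have hbound : ∀ x ∈ Icc a b, |deriv (deriv u) x| ≤ (∫ x in a..b, |q x|) * |u c| := by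
    intro x hx
    have hsub : uIcc ξ x ⊆ Icc a b := uIcc_subset_Icc hξmem hx
    have hftc : ∫ t in ξ..x, deriv (deriv (deriv u)) t = deriv (deriv u) x := by
      rw [intervalIntegral.integral_deriv_eq_sub (fun t _ => hu2 t)
        (hcont.mono hsub).intervalIntegrable, hξ, sub_zero]
    have hint := hcont.abs.intervalIntegrable_of_Icc (μ := MeasureTheory.volume) hab.le
    calc |deriv (deriv u) x|
        = |∫ t in ξ..x, deriv (deriv (deriv u)) t| := by rw [hftc]
      _ ≤ |∫ t in ξ..x, (|deriv (deriv (deriv u)) t|)| :=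
          intervalIntegral.norm_integral_le_abs_integral_norm (f := deriv (deriv (deriv u)))
      _ ≤ |∫ t in a..b, (|deriv (deriv (deriv u)) t|)| :=
          intervalIntegral.abs_integral_mono_interval
            (by
              rw [uIoc_of_le hab.le]
              exact Ioc_subset_Ioc (le_min hξmem.1 hx.1) (max_le hξmem.2 hx.2))
            (Filter.Eventually.of_forall fun t => abs_nonneg _) hint
      _ = ∫ t in a..b, |deriv (deriv (deriv u)) t| :=
          abs_of_nonneg (intervalIntegral.integral_nonneg hab.le fun t _ => abs_nonneg _)
      _ ≤ ∫ t in a..b, |q t| * |u c| :=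
          intervalIntegral.integral_mono_on hab.le hint
            ((hq.abs.mul continuousOn_const).intervalIntegrable_of_Icc hab.le) fun t ht => by
              rw [eq_neg_of_add_eq_zero_left (hode t ht), abs_neg, abs_mul]
              exact mul_le_mul_of_nonneg_left (hM t ht) (abs_nonneg _)
      _ = (∫ x in a..b, |q x|) * |u c| := intervalIntegral.integral_mul_const _ _
  have hB := mul_nonneg hK hMpos.le
  have hupper := le_of_neg_le_deriv_deriv hab.le hB hu hu1 hua hub
    (fun x hx => (abs_le.1 (hbound x hx)).1) hc
  have hd1 : deriv (-u) = -deriv u := deriv.neg'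
  have hd2 : deriv (-deriv u) = -deriv (deriv u) := deriv.neg'
  have hlower := le_of_neg_le_deriv_deriv (f := -u) hab.le hB hu.neg
    (by rw [hd1]; exact hu1.neg) (by simp [hua]) (by simp [hub])
    (fun x hx => by
      rw [hd1, hd2]
      exact neg_le_neg (abs_le.1 (hbound x hx)).2) hc
  have hmain : |u c| ≤ (∫ x in a..b, |q x|) * |u c| * (b - a) ^ 2 / 8 := abs_le'.2 ⟨hupper, hlower⟩
  have hL : 0 < (b - a) ^ 2 := pow_pos (sub_pos.2 hab) 2
  rw [gt_iff_lt, div_lt_iff₀ hL]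
  nlinarith
end

section
/- (Parhi–Panigrahi, three-point case) Let q be continuous on [a,c] with a < b < c, and suppose u is a nontrivial solution of u''' + q(x)·u = 0 on [a,c] with u(a) = u(b) = u(c) = 0 and u(x) ≠ 0 for all x ∈ (a,b) ∪ (b,c). Then ∫ₐ^c |q(x)| dx > 4/(c−a)². -/
open Set

/-- Mean value theorem with the two endpoints in either order. -/
theorem exists_mem_uIcc_deriv_mul_sub {f : ℝ → ℝ} (hf : Differentiable ℝ f) {x y : ℝ}
    (hxy : x ≠ y) :
    ∃ ξ ∈ uIcc x y, |ξ - x| < |y - x| ∧ f y - f x = deriv f ξ * (y - x) := by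
  rcases hxy.lt_or_gt with h | h
  · obtain ⟨ξ, hξ, he⟩ := exists_deriv_eq_slope f h hf.continuous.continuousOn
      hf.differentiableOn
    refine ⟨ξ, uIcc_of_le h.le ▸ Ioo_subset_Icc_self hξ, ?_, ?_⟩
    · rw [abs_of_pos (sub_pos.2 hξ.1), abs_of_pos (sub_pos.2 h)]
      linarith [hξ.2]
    · rw [he, div_mul_cancel₀ _ (sub_pos.2 h).ne']
  · obtain ⟨ξ, hξ, he⟩ := exists_deriv_eq_slope f h hf.continuous.continuousOn
      hf.differentiableOn
    refine ⟨ξ, uIcc_of_ge h.le ▸ Ioo_subset_Icc_self hξ, ?_, ?_⟩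
    · rw [abs_of_neg (sub_neg.2 hξ.2), abs_of_neg (sub_neg.2 h)]
      linarith [hξ.1]
    · have := (sub_pos.2 h).ne'
      rw [he]
      field_simp
      ring

/-- If `deriv g = -q u` on `[a, c]` and `|u| ≤ M` there, then `g` oscillates by at most `M ∫ |q|`. -/
theorem abs_sub_le_mul_integral_abs {a c M : ℝ} {q u g : ℝ → ℝ} (hac : a ≤ c)
    (hq : ContinuousOn q (Icc a c)) (hu : ContinuousOn u (Icc a c)) (hg : Differentiable ℝ g)
    (hode : ∀ x ∈ Icc a c, deriv g x + q x * u x = 0) (hM : ∀ x ∈ Icc a c, |u x| ≤ M)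
    {x y : ℝ} (hx : x ∈ Icc a c) (hy : y ∈ Icc a c) :
    |g y - g x| ≤ M * ∫ t in a..c, |q t| := by
  wlog hxy : x ≤ y generalizing x y
  · rw [abs_sub_comm]
    exact this hy hx (le_of_not_ge hxy)
  have hsub : Icc x y ⊆ Icc a c := Icc_subset_Icc hx.1 hy.2
  have hcont : ContinuousOn (deriv g) (Icc x y) :=
    ((hq.mul hu).neg.mono hsub).congr fun t ht => by
      simpa using eq_neg_of_add_eq_zero_left (hode t (hsub ht))
  have hqi : IntervalIntegrable (fun t => M * |q t|) MeasureTheory.volume a c :=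
    (ContinuousOn.intervalIntegrable_of_Icc hac (hq.abs.const_smul M))
  have hM0 : 0 ≤ M := (abs_nonneg _).trans (hM x hx)
  rw [← intervalIntegral.integral_deriv_eq_sub (fun t _ => hg t)
    (hcont.intervalIntegrable_of_Icc hxy), ← intervalIntegral.integral_const_mul]
  calc |∫ t in x..y, deriv g t| ≤ ∫ t in x..y, |deriv g t| :=
        intervalIntegral.abs_integral_le_integral_abs hxy
    _ ≤ ∫ t in x..y, M * |q t| := by
        refine intervalIntegral.integral_mono_on hxy
          (hcont.abs.intervalIntegrable_of_Icc hxy)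
          (((hq.abs.const_smul M).mono hsub).intervalIntegrable_of_Icc hxy) fun t ht => ?_
        rw [eq_neg_of_add_eq_zero_left (hode t (hsub ht)), abs_neg, abs_mul, mul_comm]
        exact mul_le_mul_of_nonneg_right (hM t (hsub ht)) (abs_nonneg _)
    _ ≤ ∫ t in a..c, M * |q t| :=
        intervalIntegral.integral_mono_interval hx.1 hxy hy.2
          (Filter.Eventually.of_forall fun t => mul_nonneg hM0 (abs_nonneg _)) hqi

theorem parhi_panigrahi_three_point
    (a b c : ℝ) (q u : ℝ → ℝ)
    (hab : a < b) (hbc : b < c)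
    (hq : ContinuousOn q (Icc a c))
    (hu : Differentiable ℝ u)
    (hu1 : Differentiable ℝ (deriv u))
    (hu2 : Differentiable ℝ (deriv (deriv u)))
    (hode : ∀ x ∈ Icc a c, deriv (deriv (deriv u)) x + q x * u x = 0)
    (hua : u a = 0) (hub : u b = 0) (huc : u c = 0)
    (hune : ∀ x ∈ Ioo a b ∪ Ioo b c, u x ≠ 0) :
    (∫ x in a..c, |q x|) > 4 / (c - a) ^ 2 := by
  have hac : a < c := hab.trans hbc
  obtain ⟨d, hd, hd0⟩ : ∃ d ∈ Icc a c, deriv (deriv u) d = 0 := by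
    obtain ⟨x₁, h₁, e₁⟩ := exists_deriv_eq_zero hab hu.continuous.continuousOn (hua.trans hub.symm)
    obtain ⟨x₂, h₂, e₂⟩ := exists_deriv_eq_zero hbc hu.continuous.continuousOn (hub.trans huc.symm)
    obtain ⟨d, hd, e⟩ := exists_deriv_eq_zero (h₁.2.trans h₂.1) hu1.continuous.continuousOn
      (e₁.trans e₂.symm)
    exact ⟨d, ⟨(h₁.1.trans hd.1).le, (hd.2.trans h₂.2).le⟩, e⟩
  obtain ⟨x₀, hx₀, hmax⟩ := isCompact_Icc.exists_isMaxOn (nonempty_Icc.2 hac.le)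
    (hu.continuous.pow 2).continuousOn
  have hM : ∀ x ∈ Icc a c, |u x| ≤ |u x₀| := fun x hx => sq_le_sq.1 (hmax hx)
  have hpos : 0 < |u x₀| := by
    obtain ⟨m, hm⟩ := exists_between hab
    exact (abs_pos.2 (hune m (Or.inl hm))).trans_le (hM m ⟨hm.1.le, (hm.2.trans hbc).le⟩)
  have hne : u x₀ ≠ 0 := abs_pos.1 hpos
  have hxa : a < x₀ := hx₀.1.lt_of_ne fun h => hne (h ▸ hua)
  have hxc : x₀ < c := hx₀.2.lt_of_ne fun h => hne (h ▸ huc)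
  have hcrit : deriv u x₀ = 0 := by
    have h := (hmax.isLocalMax (Icc_mem_nhds hxa hxc)).hasDerivAt_eq_zero
      ((hu x₀).hasDerivAt.pow 2)
    simpa [hne] using h
  obtain ⟨z, hz, huz, hzx⟩ : ∃ z ∈ Icc a c, u z = 0 ∧ |z - x₀| ≤ (c - a) / 2 := by
    rcases le_total (x₀ - a) ((c - a) / 2) with h | h
    · exact ⟨a, left_mem_Icc.2 hac.le, hua, by rwa [abs_sub_comm, abs_of_pos (sub_pos.2 hxa)]⟩
    · exact ⟨c, right_mem_Icc.2 hac.le, huc, by rw [abs_of_pos (sub_pos.2 hxc)]; linarith⟩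
  obtain ⟨ξ, hξ, hlt, eξ⟩ := exists_mem_uIcc_deriv_mul_sub hu
    (show x₀ ≠ z from fun h => hne (h ▸ huz))
  have hξI : ξ ∈ Icc a c := uIcc_subset_Icc hx₀ hz hξ
  have hξne : x₀ ≠ ξ := by
    rintro rfl
    rw [hcrit, huz, zero_mul, zero_sub, neg_eq_zero] at eξ
    exact hne eξ
  obtain ⟨η, hη, -, eη⟩ := exists_mem_uIcc_deriv_mul_sub hu1 hξne
  have hK := abs_sub_le_mul_integral_abs hac.le hq hu.continuous.continuousOn hu2 hode hM hd
    (uIcc_subset_Icc hx₀ hξI hη)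
  rw [hd0, sub_zero] at hK
  rw [hcrit, sub_zero] at eη
  have hval : |u x₀| = |deriv (deriv u) η| * (|ξ - x₀| * |z - x₀|) := by
    rw [← mul_assoc, ← abs_mul, ← abs_mul, ← eη, ← eξ, huz, zero_sub, abs_neg]
  set I := ∫ x in a..c, |q x|
  have hprod : |ξ - x₀| * |z - x₀| < (c - a) ^ 2 / 4 := by
    nlinarith [abs_nonneg (ξ - x₀), abs_nonneg (z - x₀)]
  have hprod0 : 0 ≤ |ξ - x₀| * |z - x₀| := by positivity
  have hone : 1 ≤ I * (|ξ - x₀| * |z - x₀|) := by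
    refine le_of_mul_le_mul_left ?_ hpos
    rw [mul_one, ← mul_assoc]
    exact hval.trans_le (mul_le_mul_of_nonneg_right hK hprod0)
  have hI : 0 < I := pos_of_mul_pos_left (one_pos.trans_le hone) hprod0
  rw [gt_iff_lt, div_lt_iff₀ (pow_pos (sub_pos.2 hac) 2)]
  nlinarith [mul_lt_mul_of_pos_left hprod hI]
end

section
/- Let ψ₁ : ℝ → ℝ be continuous, odd, and strictly increasing, sub-multiplicative on [0,∞) (ψ₁(x·y) ≤ ψ₁(x)·ψ₁(y) for all x,y ≥ 0), with s ↦ 1/ψ₁(s) convex on (0,∞). Let u : [a,b] → ℝ be differentiable with a < b, u(a) = u(b) = 0, and u(x) > 0 for all x ∈ (a,b), and let c ∈ (a,b) be a point at which u attains its maximum on [a,b]. Then there exist τ₁ ∈ (a,c) and τ₂ ∈ (c,b) such that ψ₁(u'(τ₁)) − ψ₁(u'(τ₂)) ≥ 2·ψ₁(u(c)) / ψ₁((b−a)/2). -/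
open Set

theorem key_intermediate_estimate
    (ψ₁ : ℝ → ℝ) (u : ℝ → ℝ) (a b c : ℝ)
    (hab : a < b)
    (hψ₁cont : Continuous ψ₁) (hψ₁odd : ∀ s, ψ₁ (-s) = -ψ₁ s)
    (hψ₁mono : StrictMono ψ₁)
    (hψ₁sub : ∀ x y : ℝ, 0 ≤ x → 0 ≤ y → ψ₁ (x * y) ≤ ψ₁ x * ψ₁ y)
    (hψ₁conv : ConvexOn ℝ (Ioi (0 : ℝ)) (fun s => 1 / ψ₁ s))
    (hu : Differentiable ℝ u)
    (hua : u a = 0) (hub : u b = 0)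
    (hupos : ∀ x ∈ Ioo a b, 0 < u x)
    (hc : c ∈ Ioo a b)
    (hmax : ∀ x ∈ Icc a b, u x ≤ u c) :
    ∃ τ₁ ∈ Ioo a c, ∃ τ₂ ∈ Ioo c b,
      2 * ψ₁ (u c) / ψ₁ ((b - a) / 2) ≤ ψ₁ (deriv u τ₁) - ψ₁ (deriv u τ₂) := by
  obtain ⟨hac, hcb⟩ := hc
  have h0 : ψ₁ 0 = 0 := by
    have h := hψ₁odd 0
    rw [neg_zero] at h
    linarith
  have hpos : ∀ s, 0 < s → 0 < ψ₁ s := fun s hs => h0 ▸ hψ₁mono hs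
  have hdiv : ∀ h, 0 < h → ψ₁ (u c) * (1 / ψ₁ h) ≤ ψ₁ (u c / h) := by
    intro h hh
    have hs := hψ₁sub (u c / h) h (div_pos (hupos c ⟨hac, hcb⟩) hh).le hh.le
    rw [div_mul_cancel₀ _ hh.ne'] at hs
    rwa [mul_one_div, div_le_iff₀ (hpos h hh)]
  obtain ⟨τ₁, hτ₁, h₁⟩ := exists_deriv_eq_slope u hac hu.continuous.continuousOn
    hu.differentiableOn
  obtain ⟨τ₂, hτ₂, h₂⟩ := exists_deriv_eq_slope u hcb hu.continuous.continuousOn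
    hu.differentiableOn
  refine ⟨τ₁, hτ₁, τ₂, hτ₂, ?_⟩
  rw [h₁, h₂, hua, hub, sub_zero, zero_sub, neg_div, hψ₁odd, sub_neg_eq_add]
  have hca : 0 < c - a := sub_pos.2 hac
  have hbc : 0 < b - c := sub_pos.2 hcb
  have hconv := hψ₁conv.2 (mem_Ioi.2 hca) (mem_Ioi.2 hbc)
    (by norm_num : (0 : ℝ) ≤ 1 / 2) (by norm_num : (0 : ℝ) ≤ 1 / 2) (by norm_num)
  simp only [smul_eq_mul] at hconv
  rw [show 1 / 2 * (c - a) + 1 / 2 * (b - c) = (b - a) / 2 by ring] at hconv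
  calc 2 * ψ₁ (u c) / ψ₁ ((b - a) / 2)
      = 2 * ψ₁ (u c) * (1 / ψ₁ ((b - a) / 2)) := (mul_one_div _ _).symm
    _ ≤ 2 * ψ₁ (u c) * (1 / 2 * (1 / ψ₁ (c - a)) + 1 / 2 * (1 / ψ₁ (b - c))) :=
        mul_le_mul_of_nonneg_left hconv
          (mul_pos two_pos (hpos _ (hupos c ⟨hac, hcb⟩))).le
    _ = ψ₁ (u c) * (1 / ψ₁ (c - a)) + ψ₁ (u c) * (1 / ψ₁ (b - c)) := by ring
    _ ≤ ψ₁ (u c / (c - a)) + ψ₁ (u c / (b - c)) := add_le_add (hdiv _ hca) (hdiv _ hbc)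
end
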